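/- arXiv:2204.11347 — 4 statements merged into one kernel-verified Lean document; each statement's English description precedes it below -/
import Mathlib

section
/- Let θ₁ < θ₂ be real numbers, let f : [θ₁,θ₂] → ℝ be twice continuously differentiable, let γ > 1, and let I ⊆ [θ₁,θ₂] be a closed interval. Suppose that for positive constants A and α with α < 2γ − 2 one of the following holds: f(s) f''(s) ≤ −A (s − θ₁)^α for all s ∈ I, or f(s) f''(s) ≤ −A (θ₂ − s)^α for all s ∈ I. Then there exists a constant C > 0 depending only on A, α, θ₁, θ₂ and γ (in particular, not on f or I) such that ∫_I |f(s)|^{−1/γ} ds ≤ C. -/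
open MeasureTheory Real

/-- A nonnegative concave function on `[u, v]` lies above a tent of height `f m`. -/
lemma ConcaveOn.mul_sub_le_or_mul_sub_le {f : ℝ → ℝ} {u v m s : ℝ}
    (hf : ConcaveOn ℝ (Set.Icc u v) f) (h0 : ∀ x ∈ Set.Icc u v, 0 ≤ f x)
    (hm : m ∈ Set.Icc u v) (hs : s ∈ Set.Ioo u v) :
    f m / (v - u) * (s - u) ≤ f s ∨ f m / (v - u) * (v - s) ≤ f s := by
  obtain ⟨hmu, hmv⟩ := hm
  obtain ⟨hsu, hsv⟩ := hs
  have huv : u < v := hsu.trans hsv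
  have hfm := h0 m ⟨hmu, hmv⟩
  rcases le_total s m with hsm | hms
  · left
    have hum : 0 < m - u := by linarith
    have key := hf.2 (Set.left_mem_Icc.2 huv.le) ⟨hmu, hmv⟩
      (show 0 ≤ (m - s) / (m - u) from div_nonneg (by linarith) hum.le)
      (show 0 ≤ (s - u) / (m - u) from div_nonneg (by linarith) hum.le)
      (by field_simp; ring)
    have hcomb : (m - s) / (m - u) * u + (s - u) / (m - u) * m = s := by field_simp; ring
    simp only [smul_eq_mul] at key
    rw [hcomb] at key
    have h1 : 0 ≤ (m - s) / (m - u) * f u :=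
      mul_nonneg (div_nonneg (by linarith) hum.le) (h0 u (Set.left_mem_Icc.2 huv.le))
    have h2 : f m / (v - u) * (s - u) ≤ (s - u) / (m - u) * f m := by
      rw [div_mul_eq_mul_div, div_mul_eq_mul_div, mul_comm (f m)]
      exact div_le_div_of_nonneg_left (mul_nonneg (by linarith) hfm) hum (by linarith)
    linarith
  · right
    have hmv' : 0 < v - m := by linarith
    have key := hf.2 ⟨hmu, hmv⟩ (Set.right_mem_Icc.2 huv.le)
      (show 0 ≤ (v - s) / (v - m) from div_nonneg (by linarith) hmv'.le)
      (show 0 ≤ (s - m) / (v - m) from div_nonneg (by linarith) hmv'.le)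
      (by field_simp; ring)
    have hcomb : (v - s) / (v - m) * m + (s - m) / (v - m) * v = s := by field_simp; ring
    simp only [smul_eq_mul] at key
    rw [hcomb] at key
    have h1 : 0 ≤ (s - m) / (v - m) * f v :=
      mul_nonneg (div_nonneg (by linarith) hmv'.le) (h0 v (Set.right_mem_Icc.2 huv.le))
    have h2 : f m / (v - u) * (v - s) ≤ (v - s) / (v - m) * f m := by
      rw [div_mul_eq_mul_div, div_mul_eq_mul_div, mul_comm (f m)]
      exact div_le_div_of_nonneg_left (mul_nonneg (by linarith) hfm) hmv' (by linarith)
    linarith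

lemma lintegral_sub_rpow_add_sub_rpow {u v p K : ℝ} (huv : u ≤ v) (hp1 : p < 1) (hK : 0 ≤ K) :
    ∫⁻ s in Set.Ioc u v, ENNReal.ofReal (K * ((s - u) ^ (-p) + (v - s) ^ (-p))) =
      ENNReal.ofReal (K * (2 / (1 - p) * (v - u) ^ (1 - p))) := by
  have hp : -1 < -p := by linarith
  have hl : IntervalIntegrable (fun s => (s - u) ^ (-p)) volume u v := by
    simpa using (intervalIntegral.intervalIntegrable_rpow' (a := 0) (b := v - u) hp).comp_sub_right u
  have hr : IntervalIntegrable (fun s => (v - s) ^ (-p)) volume u v := by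
    simpa using (intervalIntegral.intervalIntegrable_rpow' (a := v - u) (b := 0) hp).comp_sub_left v
  have hint := (hl.add hr).const_mul K
  rw [← ofReal_integral_eq_lintegral_ofReal
    ((intervalIntegrable_iff_integrableOn_Ioc_of_le huv).1 hint)]
  · rw [← intervalIntegral.integral_of_le huv, intervalIntegral.integral_const_mul,
      intervalIntegral.integral_add hl hr,
      intervalIntegral.integral_comp_sub_right (fun x => x ^ (-p)),
      intervalIntegral.integral_comp_sub_left (fun x => x ^ (-p)), sub_self, sub_self,
      integral_rpow (Or.inl hp), Real.zero_rpow (by linarith)]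
    congr 2
    rw [neg_add_eq_sub]
    ring
  · filter_upwards [ae_restrict_mem measurableSet_Ioc] with s hs
    exact mul_nonneg hK (add_nonneg (rpow_nonneg (by linarith [hs.1]) _)
      (rpow_nonneg (by linarith [hs.2]) _))

lemma ConcaveOn.lintegral_rpow_neg_le {f : ℝ → ℝ} {u v m p : ℝ} (huv : u < v)
    (hp0 : 0 ≤ p) (hp1 : p < 1)
    (hf : ConcaveOn ℝ (Set.Icc u v) f) (h0 : ∀ x ∈ Set.Icc u v, 0 ≤ f x)
    (hm : m ∈ Set.Icc u v) (hfm : 0 < f m) :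
    ∫⁻ s in Set.Icc u v, ENNReal.ofReal (|f s| ^ (-p)) ≤
      ENNReal.ofReal (2 / (1 - p) * f m ^ (-p) * (v - u)) := by
  have hl : 0 < v - u := by linarith
  have hK : 0 < f m / (v - u) := by positivity
  have hconst : 2 / (1 - p) * f m ^ (-p) * (v - u) =
      (f m / (v - u)) ^ (-p) * (2 / (1 - p) * (v - u) ^ (1 - p)) := by
    rw [div_rpow hfm.le hl.le, sub_eq_add_neg 1 p, rpow_add hl, rpow_one]
    field_simp
  rw [hconst, ← lintegral_sub_rpow_add_sub_rpow huv.le hp1 (rpow_nonneg hK.le _),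
    setLIntegral_congr Ioo_ae_eq_Icc.symm, setLIntegral_congr Ioo_ae_eq_Ioc.symm]
  refine setLIntegral_mono' measurableSet_Ioo fun s hs => ENNReal.ofReal_le_ofReal ?_
  have hsu : 0 < s - u := by linarith [hs.1]
  have hsv : 0 < v - s := by linarith [hs.2]
  rw [abs_of_nonneg (h0 s (Set.Ioo_subset_Icc_self hs)), mul_add, ← mul_rpow hK.le hsu.le,
    ← mul_rpow hK.le hsv.le]
  rcases hf.mul_sub_le_or_mul_sub_le h0 hm hs with h | h
  · exact (rpow_le_rpow_of_nonpos (by positivity) h (by linarith)).trans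
      (le_add_of_nonneg_right (by positivity))
  · exact (rpow_le_rpow_of_nonpos (by positivity) h (by linarith)).trans
      (le_add_of_nonneg_left (by positivity))

/-- If `f'' ≤ -K` on `[a, b]`, the midpoint value exceeds the average of the endpoint values by at
least `K (b - a)² / 8`. -/
lemma mul_sq_div_eight_le_midpoint {f f' f'' : ℝ → ℝ} {a b K : ℝ} (hab : a ≤ b)
    (hcont : ContinuousOn f (Set.Icc a b))
    (hf : ∀ s ∈ Set.Ioo a b, HasDerivAt f (f' s) s)
    (hf' : ∀ s ∈ Set.Ioo a b, HasDerivAt f' (f'' s) s)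
    (hK : ∀ s ∈ Set.Ioo a b, f'' s ≤ -K) (ha : 0 ≤ f a) (hb : 0 ≤ f b) :
    K * (b - a) ^ 2 / 8 ≤ f ((a + b) / 2) := by
  have hconc : ConcaveOn ℝ (Set.Icc a b) (fun s => f s + K / 2 * s ^ 2) := by
    refine concaveOn_of_hasDerivWithinAt2_nonpos (f' := fun s => f' s + K * s)
      (f'' := fun s => f'' s + K) (convex_Icc a b) (hcont.add (by fun_prop)) ?_ ?_ ?_
    all_goals rw [interior_Icc]; intro s hs
    · have h := (hf s hs).add (((hasDerivAt_id s).pow 2).const_mul (K / 2))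
      refine (h.congr_deriv ?_).hasDerivWithinAt
      simp
      ring
    · have h := (hf' s hs).add ((hasDerivAt_id s).const_mul K)
      refine (h.congr_deriv ?_).hasDerivWithinAt
      simp
    · linarith [hK s hs]
  have key := hconc.2 (Set.left_mem_Icc.2 hab) (Set.right_mem_Icc.2 hab)
    (show (0 : ℝ) ≤ 1 / 2 by norm_num) (show (0 : ℝ) ≤ 1 / 2 by norm_num) (by norm_num)
  simp only [smul_eq_mul] at key
  rw [show 1 / 2 * a + 1 / 2 * b = (a + b) / 2 by ring] at key
  nlinarith

lemma lintegral_rpow_neg_le_of_mul_deriv2_le {f f' f'' : ℝ → ℝ} {u v a b p B : ℝ}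
    (hp0 : 0 ≤ p) (hp1 : p < 1) (hB : 0 < B) (hab : a < b) (hua : u ≤ a) (hbv : b ≤ v)
    (hcont : ContinuousOn f (Set.Icc u v))
    (hf : ∀ s ∈ Set.Ioo u v, HasDerivAt f (f' s) s)
    (hf' : ∀ s ∈ Set.Ioo u v, HasDerivAt f' (f'' s) s)
    (hpos : ∀ s ∈ Set.Ioo u v, 0 < f s)
    (hle : ∀ s ∈ Set.Ioo u v, f s * f'' s ≤ 0)
    (hleB : ∀ s ∈ Set.Ioo a b, f s * f'' s ≤ -B) :
    ∫⁻ s in Set.Icc u v, ENNReal.ofReal (|f s| ^ (-p)) ≤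
      ENNReal.ofReal (2 / (1 - p) * (B * (b - a) ^ 2 / 8) ^ (-(p / 2)) * (v - u)) := by
  have huv : u < v := by linarith
  have h0 : ∀ x ∈ Set.Icc u v, 0 ≤ f x := by
    have hcl : closure (Set.Ioo u v) = Set.Icc u v := closure_Ioo huv.ne
    intro x hx
    rw [← hcl] at hx hcont
    exact ContinuousWithinAt.closure_le hx continuousWithinAt_const
      ((hcont x hx).mono subset_closure) fun y hy => (hpos y hy).le
  obtain ⟨m, hm, hmax⟩ := isCompact_Icc.exists_isMaxOn (Set.nonempty_Icc.2 huv.le) hcont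
  have hsub : Set.Ioo a b ⊆ Set.Ioo u v := Set.Ioo_subset_Ioo hua hbv
  have hmid : (a + b) / 2 ∈ Set.Ioo u v := hsub ⟨by linarith, by linarith⟩
  have hfm : 0 < f m := (hpos _ hmid).trans_le (hmax (Set.Ioo_subset_Icc_self hmid))
  have hconc : ConcaveOn ℝ (Set.Icc u v) f := by
    refine concaveOn_of_hasDerivWithinAt2_nonpos (f' := f') (f'' := f'') (convex_Icc u v) hcont
      ?_ ?_ ?_
    all_goals rw [interior_Icc]; intro s hs
    · exact (hf s hs).hasDerivWithinAt
    · exact (hf' s hs).hasDerivWithinAt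
    · exact nonpos_of_mul_nonpos_right (hle s hs) (hpos s hs)
  have hgap : B / f m * (b - a) ^ 2 / 8 ≤ f ((a + b) / 2) := by
    refine mul_sq_div_eight_le_midpoint hab.le (hcont.mono (Set.Icc_subset_Icc hua hbv))
      (fun s hs => hf s (hsub hs)) (fun s hs => hf' s (hsub hs)) (fun s hs => ?_)
      (h0 a ⟨hua, by linarith⟩) (h0 b ⟨by linarith, hbv⟩)
    have hs' := hsub hs
    have hneg : f'' s ≤ 0 := nonpos_of_mul_nonpos_right (hle s hs') (hpos s hs')
    have hfs : f s ≤ f m := hmax (Set.Ioo_subset_Icc_self hs')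
    rw [le_neg, div_le_iff₀ hfm]
    nlinarith [hleB s hs]
  have hsq : B * (b - a) ^ 2 / 8 ≤ f m ^ 2 := by
    have h := hgap.trans (hmax (Set.Ioo_subset_Icc_self hmid))
    rw [div_mul_eq_mul_div, div_div, div_le_iff₀ (by positivity)] at h
    linarith
  have hba : 0 < b - a := by linarith
  refine (hconc.lintegral_rpow_neg_le huv hp0 hp1 h0 hm hfm).trans (ENNReal.ofReal_le_ofReal ?_)
  have hpow : f m ^ (-p) ≤ (B * (b - a) ^ 2 / 8) ^ (-(p / 2)) := by
    refine le_trans (le_of_eq ?_)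
      (rpow_le_rpow_of_nonpos (by positivity) hsq (by linarith))
    rw [← rpow_natCast, ← rpow_mul hfm.le]
    congr 1
    push_cast
    ring
  have : 0 < 1 - p := by linarith
  have : 0 ≤ v - u := by linarith
  gcongr

/-- Version of `lintegral_rpow_neg_le_of_mul_deriv2_le` where the sign of `f` is not prescribed. -/
lemma lintegral_abs_rpow_neg_le_of_mul_deriv2_le {f f' f'' : ℝ → ℝ} {u v a b p B : ℝ}
    (hp0 : 0 ≤ p) (hp1 : p < 1) (hB : 0 < B) (hab : a < b) (hua : u ≤ a) (hbv : b ≤ v)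
    (hcont : ContinuousOn f (Set.Icc u v))
    (hf : ∀ s ∈ Set.Ioo u v, HasDerivAt f (f' s) s)
    (hf' : ∀ s ∈ Set.Ioo u v, HasDerivAt f' (f'' s) s)
    (hlt : ∀ s ∈ Set.Ioo u v, f s * f'' s < 0)
    (hleB : ∀ s ∈ Set.Ioo a b, f s * f'' s ≤ -B) :
    ∫⁻ s in Set.Icc u v, ENNReal.ofReal (|f s| ^ (-p)) ≤
      ENNReal.ofReal (2 / (1 - p) * (B * (b - a) ^ 2 / 8) ^ (-(p / 2)) * (v - u)) := by
  have hne : ∀ s ∈ Set.Ioo u v, f s ≠ 0 := fun s hs h => by simpa [h] using hlt s hs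
  have hsign : (∀ s ∈ Set.Ioo u v, 0 < f s) ∨ ∀ s ∈ Set.Ioo u v, 0 < -f s := by
    by_contra! h
    obtain ⟨⟨x, hx, hfx⟩, y, hy, hfy⟩ := h
    obtain ⟨z, hz, hfz⟩ := isPreconnected_Ioo.intermediate_value hx hy
      (hcont.mono Set.Ioo_subset_Icc_self) ⟨hfx, by linarith⟩
    exact hne z hz hfz
  rcases hsign with hpos | hpos
  · exact lintegral_rpow_neg_le_of_mul_deriv2_le hp0 hp1 hB hab hua hbv hcont hf hf' hpos
      (fun s hs => (hlt s hs).le) hleB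
  · simpa using lintegral_rpow_neg_le_of_mul_deriv2_le (f := fun s => -f s)
      (f' := fun s => -f' s) (f'' := fun s => -f'' s) hp0 hp1 hB hab hua hbv hcont.neg
      (fun s hs => (hf s hs).neg) (fun s hs => (hf' s hs).neg) hpos
      (fun s hs => by simpa using (hlt s hs).le) (fun s hs => by simpa using hleB s hs)

lemma two_div_mul_rpow_mul_le {A α p h T : ℝ} (hA : 0 < A) (hp1 : p < 1)
    (hαp : (α + 2) * (p / 2) ≤ 1) (hh : 0 < h) (hT : h ≤ T) :
    2 / (1 - p) * (A * h ^ α * h ^ 2 / 8) ^ (-(p / 2)) * (2 * h) ≤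
      4 / (1 - p) * (A / 8) ^ (-(p / 2)) * T ^ (1 - (α + 2) * (p / 2)) := by
  have hp : 0 < 1 - p := by linarith
  have hpow : (A * h ^ α * h ^ 2 / 8) ^ (-(p / 2)) * h =
      (A / 8) ^ (-(p / 2)) * h ^ (1 - (α + 2) * (p / 2)) := by
    rw [show A * h ^ α * h ^ 2 / 8 = A / 8 * h ^ (α + 2) by
      rw [rpow_add hh, rpow_two]; ring,
      mul_rpow (by positivity) (by positivity), ← rpow_mul hh.le, mul_assoc]
    congr 1
    nth_rewrite 2 [← rpow_one h]
    rw [← rpow_add hh]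
    congr 1
    ring
  calc _ = 4 / (1 - p) * ((A * h ^ α * h ^ 2 / 8) ^ (-(p / 2)) * h) := by ring
    _ = 4 / (1 - p) * (A / 8) ^ (-(p / 2)) * h ^ (1 - (α + 2) * (p / 2)) := by
      rw [hpow, mul_assoc]
    _ ≤ _ := by
      gcongr

/-- If `f f'' ≤ −A(s−θ₁)^α` or `f f'' ≤ −A(θ₂−s)^α` on `I`, with `α < 2γ−2`, then `∫_I |f|^{−1/γ} ≤ C` with `C = C(A,α,θ₁,θ₂,γ)`. -/
theorem stmt_11 (θ₁ θ₂ A α γ : ℝ) (hθ : θ₁ < θ₂) (hA : 0 < A) (hα : 0 < α)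
    (hγ : 1 < γ) (hαγ : α < 2 * γ - 2) :
    ∃ C : ℝ, 0 < C ∧ ∀ (f f' f'' : ℝ → ℝ) (u v : ℝ),
      Set.Icc u v ⊆ Set.Icc θ₁ θ₂ →
      (hder : ∀ s ∈ Set.Icc θ₁ θ₂, HasDerivWithinAt f (f' s) (Set.Icc θ₁ θ₂) s) →
      (∀ s ∈ Set.Icc θ₁ θ₂, HasDerivWithinAt f' (f'' s) (Set.Icc θ₁ θ₂) s) →
      ContinuousOn f' (Set.Icc θ₁ θ₂) → ContinuousOn f'' (Set.Icc θ₁ θ₂) →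
      ((∀ s ∈ Set.Icc u v, f s * f'' s ≤ -(A * (s - θ₁) ^ α)) ∨
        (∀ s ∈ Set.Icc u v, f s * f'' s ≤ -(A * (θ₂ - s) ^ α))) →
      ∫⁻ s in Set.Icc u v, ENNReal.ofReal (|f s| ^ (-(1 / γ))) ≤ ENNReal.ofReal C := by
  have hγ0 : 0 < γ := by linarith
  have hp0 : 0 < 1 / γ := by positivity
  have hp1 : 1 / γ < 1 := by rwa [div_lt_one hγ0]
  have hαp : (α + 2) * (1 / γ / 2) ≤ 1 := by
    rw [div_div, mul_one_div, div_le_one (by positivity)]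
    linarith
  have hT : 0 < θ₂ - θ₁ := by linarith
  refine ⟨4 / (1 - 1 / γ) * (A / 8) ^ (-(1 / γ / 2)) *
    (θ₂ - θ₁) ^ (1 - (α + 2) * (1 / γ / 2)), ?_, ?_⟩
  · have : 0 < 1 - 1 / γ := by linarith
    positivity
  intro f f' f'' u v hsub hf hf' _ _ hor
  rcases le_or_gt v u with hvu | huv
  · rw [setLIntegral_measure_zero _ _ (by simp [hvu])]
    exact zero_le
  have hu := (hsub (Set.left_mem_Icc.2 huv.le)).1
  have hv := (hsub (Set.right_mem_Icc.2 huv.le)).2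
  have hnhds : ∀ s ∈ Set.Ioo u v, Set.Icc θ₁ θ₂ ∈ nhds s := fun s hs =>
    Icc_mem_nhds (hu.trans_lt hs.1) (hs.2.trans_le hv)
  have hcont : ContinuousOn f (Set.Icc u v) := fun s hs =>
    (hf s (hsub hs)).continuousWithinAt.mono hsub
  have hd : ∀ s ∈ Set.Ioo u v, HasDerivAt f (f' s) s := fun s hs =>
    (hf s (hsub (Set.Ioo_subset_Icc_self hs))).hasDerivAt (hnhds s hs)
  have hd' : ∀ s ∈ Set.Ioo u v, HasDerivAt f' (f'' s) s := fun s hs =>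
    (hf' s (hsub (Set.Ioo_subset_Icc_self hs))).hasDerivAt (hnhds s hs)
  obtain ⟨h, rfl⟩ : ∃ h, v = u + 2 * h := ⟨(v - u) / 2, by ring⟩
  have hh : 0 < h := by linarith
  have hB : 0 < A * h ^ α := by positivity
  have hconst := two_div_mul_rpow_mul_le hA hp1 hαp hh (T := θ₂ - θ₁) (by linarith)
  rcases hor with hor | hor
  · have hlt : ∀ s ∈ Set.Ioo u (u + 2 * h), f s * f'' s < 0 := fun s hs => by
      have hpos : 0 < s - θ₁ := by linarith [hs.1]
      have : 0 < A * (s - θ₁) ^ α := by positivity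
      linarith [hor s (Set.Ioo_subset_Icc_self hs)]
    have hle : ∀ s ∈ Set.Ioo (u + h) (u + 2 * h), f s * f'' s ≤ -(A * h ^ α) := fun s hs => by
      refine (hor s ⟨by linarith [hs.1], hs.2.le⟩).trans (neg_le_neg ?_)
      gcongr
      linarith [hs.1]
    refine (lintegral_abs_rpow_neg_le_of_mul_deriv2_le hp0.le hp1 hB (by linarith) (by linarith)
      le_rfl hcont hd hd' hlt hle).trans (ENNReal.ofReal_le_ofReal (le_trans (le_of_eq ?_) hconst))
    ring_nf
  · have hlt : ∀ s ∈ Set.Ioo u (u + 2 * h), f s * f'' s < 0 := fun s hs => by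
      have hpos : 0 < θ₂ - s := by linarith [hs.2]
      have : 0 < A * (θ₂ - s) ^ α := by positivity
      linarith [hor s (Set.Ioo_subset_Icc_self hs)]
    have hle : ∀ s ∈ Set.Ioo u (u + h), f s * f'' s ≤ -(A * h ^ α) := fun s hs => by
      refine (hor s ⟨hs.1.le, by linarith [hs.2]⟩).trans (neg_le_neg ?_)
      gcongr
      linarith [hs.2]
    refine (lintegral_abs_rpow_neg_le_of_mul_deriv2_le hp0.le hp1 hB (by linarith) le_rfl
      (by linarith) hcont hd hd' hlt hle).trans
      (ENNReal.ofReal_le_ofReal (le_trans (le_of_eq ?_) hconst))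
    ring_nf
end

section
/- Under hypotheses (H1)–(H4), there exists a positive constant C such that |μ̂(ξ', ξ'')| ≤ C |ξ''|^{−(α₁+α₂)/m} for all ξ' ∈ ℝ² and all ξ'' ∈ ℝ² \ {0}. -/
open MeasureTheory Real Set
open scoped ENNReal

noncomputable section

/-- Nonisotropic dilation `t ∙ x = (t^{α₁} x₁, t^{α₂} x₂)` (for `t > 0`). -/
def dil (α₁ α₂ t : ℝ) (x : Fin 2 → ℝ) : Fin 2 → ℝ :=
  ![t ^ α₁ * x 0, t ^ α₂ * x 1]

/-- The region `V^{a,b} = { t ∙ (1,s) : s ∈ (a,b), t > 0 }`. -/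
def Vab (α₁ α₂ a b : ℝ) : Set (Fin 2 → ℝ) :=
  {x | ∃ s t : ℝ, a < s ∧ s < b ∧ 0 < t ∧ x = dil α₁ α₂ t ![1, s]}

/-- The region `V₁^{c,d} = { t ∙ (1,s) : s ∈ (c,d), 0 < t < 1 }`. -/
def V1 (α₁ α₂ c d : ℝ) : Set (Fin 2 → ℝ) :=
  {x | ∃ s t : ℝ, c < s ∧ s < d ∧ 0 < t ∧ t < 1 ∧ x = dil α₁ α₂ t ![1, s]}

/-- Membership in the unit circle `S¹ ⊂ ℝ²`. -/
def onS1 (ζ : Fin 2 → ℝ) : Prop := ζ 0 ^ 2 + ζ 1 ^ 2 = 1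

/-- The standard inner product on `ℝ²`. -/
def dot2 (u v : Fin 2 → ℝ) : ℝ := u 0 * v 0 + u 1 * v 1

/-- Hessian matrix of second partial derivatives of `f` at `x`. -/
def Hess (f : (Fin 2 → ℝ) → ℝ) (x : Fin 2 → ℝ) : Matrix (Fin 2) (Fin 2) ℝ :=
  Matrix.of fun i j => fderiv ℝ (fun y => fderiv ℝ f y (Pi.single j 1)) x (Pi.single i 1)

/-- The form `Q_x(ζ) = det (ζ₁ Hess φ₁(x) + ζ₂ Hess φ₂(x))`. -/
def Qform (φ : (Fin 2 → ℝ) → Fin 2 → ℝ) (x ζ : Fin 2 → ℝ) : ℝ :=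
  (ζ 0 • Hess (fun y => φ y 0) x + ζ 1 • Hess (fun y => φ y 1) x).det

/-- `x` is an elliptic point for `φ`: `min_{ζ ∈ S¹} |Q_x(ζ)| > 0`. -/
def Elliptic (φ : (Fin 2 → ℝ) → Fin 2 → ℝ) (x : Fin 2 → ℝ) : Prop :=
  ∃ ε : ℝ, 0 < ε ∧ ∀ ζ : Fin 2 → ℝ, onS1 ζ → ε ≤ |Qform φ x ζ|

/-- The symmetric matrix `K(x)` associated with the quadratic form `Q_x`,
i.e. the matrix with entries `k₁₁ = det Hess φ₁`, `k₂₂ = det Hess φ₂`,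
`k₁₂ = k₂₁ = ½(∂₁₁φ₁ ∂₂₂φ₂ + ∂₂₂φ₁ ∂₁₁φ₂ − 2 ∂₁₂φ₁ ∂₁₂φ₂)`, which satisfies
`Q_x(ζ) = ⟨K(x)ζ, ζ⟩`. -/
def Kmat (φ : (Fin 2 → ℝ) → Fin 2 → ℝ) (x : Fin 2 → ℝ) : Matrix (Fin 2) (Fin 2) ℝ :=
  Matrix.of
    ![![(Hess (fun y => φ y 0) x).det,
        ((Hess (fun y => φ y 0) x) 0 0 * (Hess (fun y => φ y 1) x) 1 1
          + (Hess (fun y => φ y 0) x) 1 1 * (Hess (fun y => φ y 1) x) 0 0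
          - 2 * (Hess (fun y => φ y 0) x) 0 1 * (Hess (fun y => φ y 1) x) 0 1) / 2],
      ![((Hess (fun y => φ y 0) x) 0 0 * (Hess (fun y => φ y 1) x) 1 1
          + (Hess (fun y => φ y 0) x) 1 1 * (Hess (fun y => φ y 1) x) 0 0
          - 2 * (Hess (fun y => φ y 0) x) 0 1 * (Hess (fun y => φ y 1) x) 0 1) / 2,
        (Hess (fun y => φ y 1) x).det]]

/-- The function `G(ζ,s) = ⟨φ(1,s), ζ⟩`. -/
def Gfun (φ : (Fin 2 → ℝ) → Fin 2 → ℝ) (ζ : Fin 2 → ℝ) (s : ℝ) : ℝ :=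
  dot2 (φ ![1, s]) ζ

/-- The standard inner product on `ℝ⁴`. -/
def dot4 (u v : Fin 4 → ℝ) : ℝ := u 0 * v 0 + u 1 * v 1 + u 2 * v 2 + u 3 * v 3

/-- The graph map `x ↦ (x, φ(x)) ∈ ℝ⁴`. -/
def graphMap (φ : (Fin 2 → ℝ) → Fin 2 → ℝ) (x : Fin 2 → ℝ) : Fin 4 → ℝ :=
  ![x 0, x 1, φ x 0, φ x 1]

/-- The Fourier transform on `ℝ⁴`, `ĝ(ξ) = ∫ e^{-i⟨x,ξ⟩} g(x) dx`. -/
def ftrans (g : (Fin 4 → ℝ) → ℂ) (ξ : Fin 4 → ℝ) : ℂ :=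
  ∫ x : Fin 4 → ℝ, Complex.exp (-Complex.I * (dot4 x ξ : ℂ)) * g x

/-- The Fourier transform of the measure `μ`,
`μ̂(ξ) = ∫_{V₁^{c,d}} e^{-i⟨(x,φ(x)),ξ⟩} dx`. -/
def muHat (α₁ α₂ c d : ℝ) (φ : (Fin 2 → ℝ) → Fin 2 → ℝ) (ξ : Fin 4 → ℝ) : ℂ :=
  ∫ x in V1 α₁ α₂ c d, Complex.exp (-Complex.I * (dot4 (graphMap φ x) ξ : ℂ))

/-- Convolution with the measure `μ`: `(μ ∗ g)(y) = ∫_{V₁^{c,d}} g(y − (x, φ(x))) dx`. -/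
def muConv (α₁ α₂ c d : ℝ) (φ : (Fin 2 → ℝ) → Fin 2 → ℝ) (g : (Fin 4 → ℝ) → ℂ)
    (y : Fin 4 → ℝ) : ℂ :=
  ∫ x in V1 α₁ α₂ c d, g (y - graphMap φ x)


/-- The function `H(ζ,s)` of Remark 2.4 / Statement 19, built from `G(ζ,s) = ⟨φ(1,s),ζ⟩`. -/
def Hfun (α₁ α₂ m : ℝ) (φ : (Fin 2 → ℝ) → Fin 2 → ℝ) (ζ : Fin 2 → ℝ) (s : ℝ) : ℝ :=
  m * (m - α₁) * Gfun φ ζ s * deriv (deriv (Gfun φ ζ)) s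
    + α₂ * (α₁ - α₂) * s * deriv (Gfun φ ζ) s * deriv (deriv (Gfun φ ζ)) s
    - (m - α₂) ^ 2 * (deriv (Gfun φ ζ) s) ^ 2

/-- `g` does not change sign on `s`. -/
def ConstSign (g : ℝ → ℝ) (s : Set ℝ) : Prop :=
  (∀ x ∈ s, 0 ≤ g x) ∨ (∀ x ∈ s, g x ≤ 0)

theorem ConstSign.mono {g : ℝ → ℝ} {s t : Set ℝ} (h : ConstSign g s) (hts : t ⊆ s) :
    ConstSign g t :=
  h.imp (fun h x hx => h x (hts hx)) (fun h x hx => h x (hts hx))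

theorem exists_constSign_split {g : ℝ → ℝ} {u v : ℝ} (huv : u ≤ v)
    (hg : ContinuousOn g (Icc u v)) (hmono : MonotoneOn g (Icc u v)) :
    ∃ w ∈ Icc u v, ConstSign g (Icc u w) ∧ ConstSign g (Icc w v) := by
  have hu : u ∈ Icc u v := left_mem_Icc.2 huv
  have hv : v ∈ Icc u v := right_mem_Icc.2 huv
  by_cases h0 : 0 ≤ g u
  · have h : ConstSign g (Icc u v) := Or.inl fun x hx => h0.trans (hmono hu hx hx.1)
    exact ⟨u, hu, h.mono (Icc_subset_Icc_right huv), h⟩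
  by_cases h1 : g v ≤ 0
  · have h : ConstSign g (Icc u v) := Or.inr fun x hx => (hmono hx hv hx.2).trans h1
    exact ⟨v, hv, h, h.mono (Icc_subset_Icc_left huv)⟩
  obtain ⟨w, hw, hw0⟩ := intermediate_value_Icc huv hg ⟨(not_le.1 h0).le, (not_le.1 h1).le⟩
  exact ⟨w, hw, Or.inr fun x hx => hw0 ▸ hmono ⟨hx.1, hx.2.trans hw.2⟩ hw hx.2,
    Or.inl fun x hx => hw0 ▸ hmono hw ⟨hw.1.trans hx.1, hx.2⟩ hx.1⟩

theorem exists_constSign_split_of_hasDerivAt {g g' : ℝ → ℝ} {u v : ℝ} (huv : u ≤ v)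
    (hg : ∀ x ∈ Icc u v, HasDerivAt g (g' x) x) (hs : ConstSign g' (Icc u v)) :
    ∃ w ∈ Icc u v, ConstSign g (Icc u w) ∧ ConstSign g (Icc w v) := by
  have hc : ContinuousOn g (Icc u v) := fun x hx => (hg x hx).continuousAt.continuousWithinAt
  rcases hs with hs | hs
  · refine exists_constSign_split huv hc ?_
    exact monotoneOn_of_hasDerivWithinAt_nonneg (convex_Icc u v) hc
      (fun x hx => (hg x (interior_subset hx)).hasDerivWithinAt)
      (fun x hx => hs x (interior_subset hx))
  · have hm : AntitoneOn g (Icc u v) :=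
      antitoneOn_of_hasDerivWithinAt_nonpos (convex_Icc u v) hc
        (fun x hx => (hg x (interior_subset hx)).hasDerivWithinAt)
        (fun x hx => hs x (interior_subset hx))
    obtain ⟨w, hw, h1, h2⟩ := exists_constSign_split huv hc.neg hm.neg
    have key : ∀ s : Set ℝ, ConstSign (-g) s → ConstSign g s := fun s h =>
      h.symm.imp (fun h x hx => neg_nonpos.1 (h x hx)) (fun h x hx => neg_nonneg.1 (h x hx))
    exact ⟨w, hw, key _ h1, key _ h2⟩

/-- The generalized polynomial `∑ aᵢ x ^ eᵢ` with real exponents. -/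
def powerSum (l : List (ℝ × ℝ)) (x : ℝ) : ℝ := (l.map fun q => q.1 * x ^ q.2).sum

@[simp] theorem powerSum_nil (x : ℝ) : powerSum [] x = 0 := rfl

@[simp] theorem powerSum_cons (q : ℝ × ℝ) (l : List (ℝ × ℝ)) (x : ℝ) :
    powerSum (q :: l) x = q.1 * x ^ q.2 + powerSum l x := rfl

/-- Coefficients and exponents of the derivative of a generalized polynomial. -/
def powerDeriv (l : List (ℝ × ℝ)) : List (ℝ × ℝ) := l.map fun q => (q.1 * q.2, q.2 - 1)

theorem hasDerivAt_powerSum (l : List (ℝ × ℝ)) {x : ℝ} (hx : 0 < x) :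
    HasDerivAt (powerSum l) (powerSum (powerDeriv l) x) x := by
  induction l with
  | nil => exact hasDerivAt_const x 0
  | cons q l ih =>
    have h := ((Real.hasDerivAt_rpow_const (p := q.2) (Or.inl hx.ne')).const_mul q.1).add ih
    refine h.congr_deriv ?_
    simp only [powerDeriv, List.map_cons, powerSum_cons]
    ring

theorem powerSum_shift (l : List (ℝ × ℝ)) (e : ℝ) {x : ℝ} (hx : 0 < x) :
    powerSum l x = x ^ e * powerSum (l.map fun q => (q.1, q.2 - e)) x := by
  induction l with
  | nil => simp
  | cons q l ih =>
    simp only [List.map_cons, powerSum_cons, ih, mul_add, Real.rpow_sub hx]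
    have := (Real.rpow_pos_of_pos hx e).ne'
    field_simp

/-- The integral of `F` over every interval `[u, v] ⊆ [1, ∞)` with `P [u, v]` is at most `K`. -/
def IntegralBoundOn (F : ℝ → ℂ) (P : Set ℝ → Prop) (K : ℝ) : Prop :=
  ∀ u v, 1 ≤ u → u ≤ v → P (Icc u v) → ‖∫ x in u..v, F x‖ ≤ K

theorem IntegralBoundOn.drop_constSign {F : ℝ → ℂ} (hF : ContinuousOn F (Ioi 0)) (n : ℕ) :
    ∀ (l : List (ℝ × ℝ)), l.length = n → ∀ {P : Set ℝ → Prop}, Antitone P → ∀ {K : ℝ}, 0 ≤ K →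
      IntegralBoundOn F (fun s => P s ∧ ConstSign (powerSum l) s) K →
      IntegralBoundOn F P (2 ^ n * K) := by
  induction n with
  | zero =>
    intro l hl P hP K hK h u v hu huv hPu
    obtain rfl := List.length_eq_zero_iff.1 hl
    simpa using h u v hu huv ⟨hPu, Or.inl fun x _ => le_rfl⟩
  | succ n ih =>
    intro l hl P hP K hK h
    obtain ⟨⟨a, e⟩, l, rfl⟩ := List.exists_cons_of_length_eq_add_one hl
    set l₁ := l.map fun q : ℝ × ℝ => (q.1, q.2 - e) with hl₁
    have hlen : (powerDeriv l₁).length = n := by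
      simpa [powerDeriv, hl₁] using hl
    rw [pow_succ, mul_assoc]
    refine ih _ hlen hP (by positivity) ?_
    rintro u v hu huv ⟨hPu, hs⟩
    have hd : ∀ x ∈ Icc u v, HasDerivAt (fun y => a + powerSum l₁ y)
        (powerSum (powerDeriv l₁) x) x := fun x hx =>
      (hasDerivAt_powerSum l₁ (by linarith [hx.1])).const_add a
    obtain ⟨w, hw, h1, h2⟩ := exists_constSign_split_of_hasDerivAt huv hd hs
    have key : ∀ s : Set ℝ, s ⊆ Icc u v → ConstSign (fun y => a + powerSum l₁ y) s →
        ConstSign (powerSum ((a, e) :: l)) s := by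
      intro s hsub h
      have heq : ∀ x ∈ s, powerSum ((a, e) :: l) x = x ^ e * (a + powerSum l₁ x) := by
        intro x hx
        have hx0 : 0 < x := by linarith [(hsub hx).1]
        rw [powerSum_shift _ e hx0]
        simp [hl₁]
      have hpos : ∀ x ∈ s, 0 ≤ x ^ e := fun x hx =>
        Real.rpow_nonneg (by linarith [(hsub hx).1]) e
      refine h.imp (fun h x hx => ?_) (fun h x hx => ?_)
      · rw [heq x hx]; exact mul_nonneg (hpos x hx) (h x hx)
      · rw [heq x hx]; exact mul_nonpos_of_nonneg_of_nonpos (hpos x hx) (h x hx)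
    have hs1 : Icc u w ⊆ Icc u v := Icc_subset_Icc_right hw.2
    have hs2 : Icc w v ⊆ Icc u v := Icc_subset_Icc_left hw.1
    have b1 := h u w hu hw.1 ⟨hP hs1 hPu, key _ hs1 h1⟩
    have b2 := h w v (hu.trans hw.1) hw.2 ⟨hP hs2 hPu, key _ hs2 h2⟩
    have hint : ∀ x y, 1 ≤ x → x ≤ y → IntervalIntegrable F volume x y := fun x y hx hxy =>
      (hF.mono fun z hz => by
        rw [uIcc_of_le hxy] at hz
        exact zero_lt_one.trans_le (hx.trans hz.1)).intervalIntegrable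
    rw [← intervalIntegral.integral_add_adjacent_intervals (hint u w hu hw.1)
      (hint w v (hu.trans hw.1) hw.2)]
    linarith [norm_add_le (∫ x in u..w, F x) (∫ x in w..v, F x)]

/-- The first derivative test for oscillatory integrals. -/
theorem norm_integral_exp_le_of_deriv_ge {f f₁ f₂ : ℝ → ℝ} {u v c : ℝ} (huv : u ≤ v) (hc : 0 < c)
    (hf : ∀ x ∈ Icc u v, HasDerivAt f (f₁ x) x) (hf₁ : ∀ x ∈ Icc u v, HasDerivAt f₁ (f₂ x) x)
    (hf₂ : ContinuousOn f₂ (Icc u v)) (hge : ∀ x ∈ Icc u v, c ≤ |f₁ x|)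
    (hs : ConstSign f₂ (Icc u v)) :
    ‖∫ x in u..v, Complex.exp (Complex.I * (f x : ℂ))‖ ≤ 4 / c := by
  have hne : ∀ x ∈ Icc u v, f₁ x ≠ 0 := fun x hx h => by
    have := hge x hx
    rw [h, abs_zero] at this
    linarith
  have hcf : ContinuousOn f (Icc u v) := fun x hx => (hf x hx).continuousAt.continuousWithinAt
  have hcf₁ : ContinuousOn f₁ (Icc u v) := fun x hx => (hf₁ x hx).continuousAt.continuousWithinAt
  have hexp : ContinuousOn (fun x => Complex.exp (Complex.I * (f x : ℂ))) (Icc u v) :=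
    (continuousOn_const.mul (Complex.continuous_ofReal.comp_continuousOn hcf)).cexp
  have hinv2 : ContinuousOn (fun x => f₂ x / f₁ x ^ 2) (Icc u v) :=
    hf₂.div (hcf₁.pow 2) fun x hx => pow_ne_zero 2 (hne x hx)
  set E : ℝ → ℂ := fun x => Complex.exp (Complex.I * (f x : ℂ)) with hE
  set r : ℝ → ℂ := fun x => Complex.I * E x * ((f₂ x / f₁ x ^ 2 : ℝ) : ℂ) with hr
  have hrc : ContinuousOn r (Icc u v) :=
    (continuousOn_const.mul hexp).mul (Complex.continuous_ofReal.comp_continuousOn hinv2)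
  have hW : ∀ x ∈ uIcc u v, HasDerivAt (fun x => -Complex.I * E x / (f₁ x : ℂ)) (E x + r x) x := by
    intro x hx
    rw [uIcc_of_le huv] at hx
    have h1 : HasDerivAt E (E x * (Complex.I * (f₁ x : ℂ))) x :=
      (((hf x hx).ofReal_comp).const_mul Complex.I).cexp
    have h2 := ((h1.const_mul (-Complex.I)).div (hf₁ x hx).ofReal_comp
      (Complex.ofReal_ne_zero.2 (hne x hx)))
    refine h2.congr_deriv ?_
    have : (f₁ x : ℂ) ≠ 0 := Complex.ofReal_ne_zero.2 (hne x hx)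
    simp only [hr, Complex.ofReal_div, Complex.ofReal_pow]
    field_simp
    linear_combination (-E x * (f₁ x : ℂ) ^ 2) * Complex.I_sq
  have hEi : IntervalIntegrable E volume u v :=
    ContinuousOn.intervalIntegrable (by rwa [uIcc_of_le huv])
  have hri : IntervalIntegrable r volume u v :=
    ContinuousOn.intervalIntegrable (by rwa [uIcc_of_le huv])
  have hftc := intervalIntegral.integral_eq_sub_of_hasDerivAt hW (hEi.add hri)
  rw [intervalIntegral.integral_add hEi hri] at hftc
  have hnE : ∀ x, ‖E x‖ = 1 := fun x => by
    simp only [hE]; rw [mul_comm]; exact Complex.norm_exp_ofReal_mul_I (f x)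
  have hWn : ∀ x ∈ Icc u v, ‖-Complex.I * E x / (f₁ x : ℂ)‖ ≤ 1 / c := by
    intro x hx
    rw [norm_div, norm_mul, norm_neg, Complex.norm_I, hnE, Complex.norm_real, Real.norm_eq_abs,
      one_mul]
    exact one_div_le_one_div_of_le hc (hge x hx)
  have hrn : ‖∫ x in u..v, r x‖ ≤ 2 / c := by
    have hQ : ∀ x ∈ uIcc u v, HasDerivAt (fun x => -(f₁ x)⁻¹) (f₂ x / f₁ x ^ 2) x := by
      intro x hx
      rw [uIcc_of_le huv] at hx
      refine ((hf₁ x hx).inv (hne x hx)).neg.congr_deriv ?_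
      ring
    have hqi : IntervalIntegrable (fun x => f₂ x / f₁ x ^ 2) volume u v :=
      ContinuousOn.intervalIntegrable (by rwa [uIcc_of_le huv])
    have hI := intervalIntegral.integral_eq_sub_of_hasDerivAt hQ hqi
    have habs : ∀ x ∈ Icc u v, |(f₁ x)⁻¹| ≤ 1 / c := fun x hx => by
      rw [abs_inv, ← one_div]
      exact one_div_le_one_div_of_le hc (hge x hx)
    have hu := abs_le.1 (habs u (left_mem_Icc.2 huv))
    have hv := abs_le.1 (habs v (right_mem_Icc.2 huv))
    have h2c : 2 / c = 1 / c + 1 / c := by ring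
    have hnr : ∀ x, ‖r x‖ = |f₂ x / f₁ x ^ 2| := fun x => by
      simp only [hr, norm_mul, hnE, Complex.norm_I, Complex.norm_real, Real.norm_eq_abs, one_mul]
    rcases hs with hs | hs
    · refine (intervalIntegral.norm_integral_le_of_norm_le huv
        (Filter.Eventually.of_forall fun x hx => ?_) hqi).trans (b := ∫ x in u..v, f₂ x / f₁ x ^ 2)
        (by rw [hI]; linarith [hu.1, hu.2, hv.1, hv.2])
      rw [hnr, abs_of_nonneg]
      exact div_nonneg (hs x (Ioc_subset_Icc_self hx)) (sq_nonneg _)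
    · refine (intervalIntegral.norm_integral_le_of_norm_le huv
        (Filter.Eventually.of_forall fun x hx => ?_) hqi.neg).trans
        (b := ∫ x in u..v, -(f₂ x / f₁ x ^ 2))
        (by rw [intervalIntegral.integral_neg, hI]; linarith [hu.1, hu.2, hv.1, hv.2])
      rw [hnr, abs_of_nonpos]
      · exact le_rfl
      · exact div_nonpos_of_nonpos_of_nonneg (hs x (Ioc_subset_Icc_self hx)) (sq_nonneg _)
  have heq : (∫ x in u..v, E x) = -Complex.I * E v / (f₁ v : ℂ) - -Complex.I * E u / (f₁ u : ℂ)
      - ∫ x in u..v, r x := by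
    rw [← hftc]; ring
  rw [heq]
  have h4 : 4 / c = 1 / c + 1 / c + 2 / c := by ring
  rw [h4]
  exact (norm_sub_le _ _).trans (add_le_add ((norm_sub_le _ _).trans
    (add_le_add (hWn v (right_mem_Icc.2 huv)) (hWn u (left_mem_Icc.2 huv)))) hrn)

theorem length_le_two_of_hasDerivAt {h h' : ℝ → ℝ} {u v c : ℝ} (huv : u ≤ v) (hc : 0 < c)
    (hd : ∀ x ∈ Icc u v, HasDerivAt h (h' x) x) (hle : ∀ x ∈ Icc u v, |h x| ≤ c)
    (hge : ∀ x ∈ Icc u v, c ≤ |h' x|) : v - u ≤ 2 := by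
  rcases huv.eq_or_lt with rfl | huv'
  · simp
  obtain ⟨y, hy, hyeq⟩ := exists_hasDerivAt_eq_slope h h' huv'
    (fun x hx => (hd x hx).continuousAt.continuousWithinAt)
    (fun x hx => hd x (Ioo_subset_Icc_self hx))
  have hpos : 0 < v - u := sub_pos.2 huv'
  have h1 := hge y (Ioo_subset_Icc_self hy)
  rw [hyeq, abs_div, abs_of_pos hpos, le_div_iff₀ hpos] at h1
  have h2 := abs_le.1 (hle u (left_mem_Icc.2 huv))
  have h3 := abs_le.1 (hle v (right_mem_Icc.2 huv))
  have h4 : |h v - h u| ≤ 2 * c := abs_le.2 ⟨by linarith [h2.2, h3.1], by linarith [h2.1, h3.2]⟩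
  nlinarith

theorem ConstSign.trichotomy {g : ℝ → ℝ} {c : ℝ} {s : Set ℝ} (hm : ConstSign (fun x => -c + g x) s)
    (hp : ConstSign (fun x => c + g x) s) :
    (∀ x ∈ s, c ≤ |g x|) ∨ (∀ x ∈ s, |g x| ≤ c) := by
  rcases hm with hm | hm
  · exact Or.inl fun x hx => le_abs.2 (Or.inl (by linarith [hm x hx]))
  rcases hp with hp | hp
  · exact Or.inr fun x hx => abs_le.2 ⟨by linarith [hp x hx], by linarith [hm x hx]⟩
  · exact Or.inl fun x hx => le_abs.2 (Or.inr (by linarith [hp x hx]))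

theorem IntegralBoundOn.of_forall_constSign {F : ℝ → ℂ} (hF : ContinuousOn F (Ioi 0)) {n : ℕ}
    {K : ℝ} (hK : 0 ≤ K) (L : List (List (ℝ × ℝ))) :
    (∀ l ∈ L, l.length = n) → ∀ {P : Set ℝ → Prop}, Antitone P →
      IntegralBoundOn F (fun s => P s ∧ ∀ l ∈ L, ConstSign (powerSum l) s) K →
      IntegralBoundOn F P ((2 ^ n) ^ L.length * K) := by
  induction L with
  | nil =>
    intro _ P _ h u v hu huv hPu
    simpa using h u v hu huv ⟨hPu, by simp⟩
  | cons l L ih =>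
    intro hl P hP h
    rw [List.length_cons, pow_succ', mul_assoc]
    refine drop_constSign hF n l (hl l (by simp)) hP (by positivity) ?_
    refine ih (fun l' hl' => hl l' (List.mem_cons_of_mem _ hl'))
      (fun s t hst hPt => ⟨hP hst hPt.1, hPt.2.mono hst⟩) ?_
    rintro u v hu huv ⟨⟨hPu, hs⟩, hL⟩
    exact h u v hu huv ⟨hPu, List.forall_mem_cons.2 ⟨hs, hL⟩⟩

theorem ConstSign.powerSum_trichotomy {l : List (ℝ × ℝ)} {c : ℝ} {s : Set ℝ}
    (hm : ConstSign (powerSum ((-c, 0) :: l)) s) (hp : ConstSign (powerSum ((c, 0) :: l)) s) :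
    (∀ x ∈ s, c ≤ |powerSum l x|) ∨ (∀ x ∈ s, |powerSum l x| ≤ c) :=
  ConstSign.trichotomy (by simpa [ConstSign] using hm) (by simpa [ConstSign] using hp)

theorem exists_norm_integral_exp_le_of_one_le {p q M : ℝ} (hp : 0 < p) (hq : 0 < q)
    (hpq : p + q = 1) (hM : 3 ≤ M) :
    ∃ K : ℝ, 0 < K ∧ ∀ a b ε : ℝ, |ε| = 1 → ∀ R : ℝ, 1 ≤ R →
      ‖∫ x in (1 : ℝ)..R, Complex.exp (Complex.I *
        ((a * x ^ p + b * x ^ q + ε * x ^ M : ℝ) : ℂ))‖ ≤ K := by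
  set c : ℝ := M * (M - p) * (M - q) / 4 with hc_def
  have hc : 0 < c := by
    have h1 : 0 < M - p := by linarith
    have h2 : 0 < M - q := by linarith
    positivity
  refine ⟨(2 ^ 4) ^ 7 * (4 / c + 2), by positivity, fun a b ε hε R hR => ?_⟩
  set l : List (ℝ × ℝ) := [(a, p), (b, q), (ε, M)] with hl
  have hf : ∀ x, a * x ^ p + b * x ^ q + ε * x ^ M = powerSum l x := fun x => by
    simp [hl, add_assoc]
  simp only [hf]
  set l₁ := powerDeriv l with hl₁
  set l₂ := powerDeriv l₁ with hl₂
  set l₃ := powerDeriv l₂ with hl₃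
  have hd (l : List (ℝ × ℝ)) {x : ℝ} (hx : 1 ≤ x) := hasDerivAt_powerSum l (zero_lt_one.trans_le hx)
  have hcont : ∀ l : List (ℝ × ℝ), ContinuousOn (powerSum l) (Ioi 0) := fun l x hx =>
    (hasDerivAt_powerSum l hx).continuousAt.continuousWithinAt
  have hF : ContinuousOn (fun x => Complex.exp (Complex.I * (powerSum l x : ℂ))) (Ioi 0) :=
    (continuousOn_const.mul (Complex.continuous_ofReal.comp_continuousOn (hcont l))).cexp
  have hlow : ∀ x : ℝ, 1 ≤ x →
      4 * c ≤ |powerSum l₃ x| + 2 * |powerSum l₂ x| + |powerSum l₁ x| := by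
    intro x hx
    have hx0 : 0 < x := zero_lt_one.trans_le hx
    have hid : 4 * c * (ε * x ^ M) = x ^ 3 * powerSum l₃ x + 2 * (x ^ 2 * powerSum l₂ x)
        + p * q * (x * powerSum l₁ x) := by
      have hq' : q = 1 - p := by linarith
      simp only [hl₃, hl₂, hl₁, hl, powerDeriv, List.map_cons, List.map_nil, powerSum_cons,
        powerSum_nil, Real.rpow_sub_one hx0.ne', hc_def]
      field_simp
      subst hq'
      ring
    have habs : 4 * c * x ^ M ≤ x ^ 3 * |powerSum l₃ x| + 2 * (x ^ 2 * |powerSum l₂ x|)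
        + p * q * (x * |powerSum l₁ x|) := by
      have h1 : |4 * c * (ε * x ^ M)| = 4 * c * x ^ M := by
        rw [abs_mul, abs_mul ε, hε, one_mul, abs_of_pos (by positivity : 0 < 4 * c),
          abs_of_pos (Real.rpow_pos_of_pos hx0 M)]
      rw [← h1, hid]
      refine (abs_add_le _ _).trans (add_le_add ((abs_add_le _ _).trans (add_le_add ?_ ?_)) ?_) <;>
        simp [abs_mul, abs_of_pos hx0, abs_of_pos hp, abs_of_pos hq]
    have hxM : x ^ 3 ≤ x ^ M := by
      rw [← Real.rpow_natCast]
      exact Real.rpow_le_rpow_of_exponent_le hx (by exact_mod_cast hM)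
    have hx2 : x ^ 2 ≤ x ^ 3 := pow_le_pow_right₀ hx (by norm_num)
    have hx1 : p * q * x ≤ x ^ 3 := by
      have : x ≤ x ^ 3 := by simpa using pow_le_pow_right₀ hx (show 1 ≤ 3 by norm_num)
      have hpq1 : p * q ≤ 1 := by nlinarith
      nlinarith
    have h3 : x ^ 3 * (4 * c) ≤
        x ^ 3 * (|powerSum l₃ x| + 2 * |powerSum l₂ x| + |powerSum l₁ x|) := by
      nlinarith [mul_le_mul_of_nonneg_right hx2 (abs_nonneg (powerSum l₂ x)),
        mul_le_mul_of_nonneg_right hx1 (abs_nonneg (powerSum l₁ x)),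
        mul_le_mul_of_nonneg_right hxM hc.le]
    exact le_of_mul_le_mul_left h3 (by positivity)
  refine IntegralBoundOn.of_forall_constSign (P := fun _ => True) (n := 4) hF (by positivity)
    [(-c, 0) :: l₁, (c, 0) :: l₁, (-c, 0) :: l₂, (c, 0) :: l₂, (-c, 0) :: l₃, (c, 0) :: l₃,
      (0, 0) :: l₂] (by simp [hl, hl₁, hl₂, hl₃, powerDeriv]) (fun _ _ _ h => h) ?_ 1 R le_rfl hR
    trivial
  rintro u v hu huv ⟨-, hL⟩
  simp only [List.forall_mem_cons, List.not_mem_nil, false_imp_iff, implies_true, and_true] at hL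
  obtain ⟨h1m, h1p, h2m, h2p, h3m, h3p, h2⟩ := hL
  have h2' : ConstSign (powerSum l₂) (Icc u v) := by simpa [ConstSign] using h2
  have h4c : (0 : ℝ) ≤ 4 / c := by positivity
  rcases h1m.powerSum_trichotomy h1p with h1 | h1
  · refine (norm_integral_exp_le_of_deriv_ge huv hc (fun x hx => hd l (hu.trans hx.1))
      (fun x hx => hd l₁ (hu.trans hx.1)) ((hcont l₂).mono fun x hx => ?_) h1 h2').trans
      (by linarith)
    exact zero_lt_one.trans_le (hu.trans hx.1)
  have hlen : v - u ≤ 2 := by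
    rcases h2m.powerSum_trichotomy h2p with h2 | h2
    · exact length_le_two_of_hasDerivAt huv hc (fun x hx => hd l₁ (hu.trans hx.1)) h1 h2
    rcases h3m.powerSum_trichotomy h3p with h3 | h3
    · exact length_le_two_of_hasDerivAt huv hc (fun x hx => hd l₂ (hu.trans hx.1)) h2 h3
    · refine length_le_two_of_hasDerivAt huv hc (fun x hx => hd l₂ (hu.trans hx.1)) h2
        fun x hx => ?_
      linarith [hlow x (hu.trans hx.1), h1 x hx, h2 x hx, h3 x hx]
  have := intervalIntegral.norm_integral_le_of_norm_le_const (a := u) (b := v) (C := 1)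
    (f := fun x => Complex.exp (Complex.I * (powerSum l x : ℂ))) fun x _ => by
      rw [mul_comm]; exact (Complex.norm_exp_ofReal_mul_I _).le
  rw [abs_of_nonneg (sub_nonneg.2 huv), one_mul] at this
  linarith

/-- Uniform decay for one-dimensional oscillatory integrals whose phase is a combination of three
powers `x ^ p`, `x ^ q`, `x ^ M` with `p + q = 1` and `M ≥ 3`. -/
theorem exists_norm_integral_exp_le_rpow {p q M : ℝ} (hp : 0 < p) (hq : 0 < q)
    (hpq : p + q = 1) (hM : 3 ≤ M) :
    ∃ K : ℝ, 0 < K ∧ ∀ a b A : ℝ, A ≠ 0 →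
      ‖∫ x in (0 : ℝ)..1, Complex.exp (Complex.I *
        ((a * x ^ p + b * x ^ q + A * x ^ M : ℝ) : ℂ))‖ ≤ K * |A| ^ (-(1 / M)) := by
  obtain ⟨K, hK, h⟩ := exists_norm_integral_exp_le_of_one_le hp hq hpq hM
  refine ⟨K + 1, by positivity, fun a b A hA => ?_⟩
  have hM0 : 0 < M := by linarith
  have hA' : 0 < |A| := abs_pos.2 hA
  set κ : ℝ := |A| ^ (-(1 / M)) with hκ
  have hκ0 : 0 < κ := Real.rpow_pos_of_pos hA' _
  have hκM : A * κ ^ M = SignType.sign A := by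
    rw [hκ, ← Real.rpow_mul hA'.le, show -(1 / M) * M = -1 by field_simp, Real.rpow_neg_one]
    nth_rewrite 1 [← sign_mul_abs A]
    field_simp
  have hε : |((SignType.sign A : SignType) : ℝ)| = 1 := by
    rcases lt_or_gt_of_ne hA with h | h <;> simp [h]
  set ε : ℝ := ((SignType.sign A : SignType) : ℝ)
  have hnorm : ∀ r : ℝ, ‖Complex.exp (Complex.I * (r : ℂ))‖ = 1 := fun r => by
    rw [mul_comm]; exact Complex.norm_exp_ofReal_mul_I _
  set G : ℝ → ℂ := fun x => Complex.exp (Complex.I *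
    (((a * κ ^ p) * x ^ p + (b * κ ^ q) * x ^ q + ε * x ^ M : ℝ) : ℂ)) with hG
  have hGc : Continuous G := by
    have : ∀ r : ℝ, 0 < r → Continuous fun x : ℝ => x ^ r := fun r hr =>
      Real.continuous_rpow_const hr.le
    have h1 := this p hp
    have h2 := this q hq
    have h3 := this M hM0
    fun_prop
  have hscale : ∫ x in (0 : ℝ)..1, Complex.exp (Complex.I *
      ((a * x ^ p + b * x ^ q + A * x ^ M : ℝ) : ℂ)) = κ • ∫ x in (0 : ℝ)..κ⁻¹, G x := by
    have := intervalIntegral.smul_integral_comp_mul_left (a := 0) (b := κ⁻¹)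
      (fun x => Complex.exp (Complex.I *
        ((a * x ^ p + b * x ^ q + A * x ^ M : ℝ) : ℂ))) κ
    rw [mul_zero, mul_inv_cancel₀ hκ0.ne'] at this
    rw [← this]
    congr 1
    refine intervalIntegral.integral_congr fun x hx => ?_
    rw [uIcc_of_le (inv_nonneg.2 hκ0.le)] at hx
    simp only [hG, Real.mul_rpow hκ0.le hx.1, ← hκM]
    congr 3
    ring
  rw [hscale, norm_smul, Real.norm_of_nonneg hκ0.le, mul_comm]
  refine mul_le_mul_of_nonneg_right ?_ hκ0.le
  have hunit : ∀ r : ℝ, 0 ≤ r → r ≤ 1 → ‖∫ x in (0 : ℝ)..r, G x‖ ≤ 1 := fun r h0 h1 => by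
    have := intervalIntegral.norm_integral_le_of_norm_le_const (a := 0) (b := r) (C := 1)
      (f := G) fun x _ => (hnorm _).le
    rw [sub_zero, abs_of_nonneg h0, one_mul] at this
    linarith
  rcases le_total κ⁻¹ 1 with h1 | h1
  · linarith [hunit _ (inv_nonneg.2 hκ0.le) h1]
  · rw [← intervalIntegral.integral_add_adjacent_intervals (hGc.intervalIntegrable 0 1)
      (hGc.intervalIntegrable 1 κ⁻¹)]
    linarith [norm_add_le (∫ x in (0 : ℝ)..1, G x) (∫ x in (1 : ℝ)..κ⁻¹, G x),
      hunit 1 zero_le_one le_rfl, h (a * κ ^ p) (b * κ ^ q) ε hε κ⁻¹ h1]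

theorem le_sub_of_hasDerivAt_of_pow_le {h h' : ℝ → ℝ} {u v c : ℝ} {k : ℕ} (hc : 0 ≤ c)
    (hd : ∀ x ∈ Icc u v, HasDerivAt h (h' x) x)
    (hle : (∀ x ∈ Icc u v, c * (x - u) ^ k ≤ h' x) ∨ (∀ x ∈ Icc u v, c * (v - x) ^ k ≤ h' x))
    {x y : ℝ} (hy : u ≤ y) (hyx : y ≤ x) (hx : x ≤ v) :
    c / (k + 1) * (x - y) ^ (k + 1) ≤ h x - h y := by
  have hk : (0 : ℝ) < k + 1 := by positivity
  have hyI : y ∈ Icc u v := ⟨hy, hyx.trans hx⟩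
  have hxI : x ∈ Icc u v := ⟨hy.trans hyx, hx⟩
  have hc' : 0 ≤ c / (k + 1) := by positivity
  rcases hle with hle | hle
  · have hd' : ∀ t ∈ Icc u v, HasDerivAt (fun t => h t - c / (k + 1) * (t - u) ^ (k + 1))
        (h' t - c * (t - u) ^ k) t := fun t ht => by
      refine ((hd t ht).sub ((((hasDerivAt_id t).sub_const u).pow (k + 1)).const_mul
        (c / (k + 1)))).congr_deriv ?_
      simp only [id, Nat.cast_add, Nat.cast_one, Nat.add_sub_cancel]
      field_simp
    have hmono := monotoneOn_of_hasDerivWithinAt_nonneg (convex_Icc u v)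
      (fun t ht => (hd' t ht).continuousAt.continuousWithinAt)
      (fun t ht => (hd' t (interior_subset ht)).hasDerivWithinAt)
      (fun t ht => sub_nonneg.2 (hle t (interior_subset ht))) hyI hxI hyx
    have hsup : (x - y) ^ (k + 1) + (y - u) ^ (k + 1) ≤ (x - u) ^ (k + 1) := by
      have := pow_add_pow_le (sub_nonneg.2 hyx) (sub_nonneg.2 hy) k.succ_ne_zero
      simpa using this
    simp only at hmono
    nlinarith [mul_le_mul_of_nonneg_left hsup hc']
  · have hd' : ∀ t ∈ Icc u v, HasDerivAt (fun t => h t + c / (k + 1) * (v - t) ^ (k + 1))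
        (h' t - c * (v - t) ^ k) t := fun t ht => by
      refine ((hd t ht).add ((((hasDerivAt_id t).const_sub v).pow (k + 1)).const_mul
        (c / (k + 1)))).congr_deriv ?_
      simp only [id, Nat.cast_add, Nat.cast_one, Nat.add_sub_cancel]
      field_simp
      ring
    have hmono := monotoneOn_of_hasDerivWithinAt_nonneg (convex_Icc u v)
      (fun t ht => (hd' t ht).continuousAt.continuousWithinAt)
      (fun t ht => (hd' t (interior_subset ht)).hasDerivWithinAt)
      (fun t ht => sub_nonneg.2 (hle t (interior_subset ht))) hyI hxI hyx
    have hsup : (x - y) ^ (k + 1) + (v - x) ^ (k + 1) ≤ (v - y) ^ (k + 1) := by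
      have := pow_add_pow_le (sub_nonneg.2 hyx) (sub_nonneg.2 hx) k.succ_ne_zero
      simpa using this
    simp only at hmono
    nlinarith [mul_le_mul_of_nonneg_left hsup hc']

/-- `h` does not change sign on `[u, v]` and grows at least like `c dist ^ k`, where `dist` is the
distance to one of the endpoints. -/
def EndpointGrowth (h : ℝ → ℝ) (c : ℝ) (k : ℕ) (u v : ℝ) : Prop :=
  ConstSign h (Icc u v) ∧
    ((∀ x ∈ Icc u v, c * (x - u) ^ k ≤ |h x|) ∨ (∀ x ∈ Icc u v, c * (v - x) ^ k ≤ |h x|))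

theorem EndpointGrowth.neg {h : ℝ → ℝ} {c : ℝ} {k : ℕ} {u v : ℝ} (H : EndpointGrowth h c k u v) :
    EndpointGrowth (-h) c k u v := by
  simpa [EndpointGrowth, ConstSign, or_comm] using H

theorem EndpointGrowth.exists_split {h h' : ℝ → ℝ} {u v c : ℝ} {k : ℕ} (huv : u ≤ v) (hc : 0 ≤ c)
    (hd : ∀ x ∈ Icc u v, HasDerivAt h (h' x) x) (H : EndpointGrowth h' c k u v) :
    ∃ w ∈ Icc u v, EndpointGrowth h (c / (k + 1)) (k + 1) u w ∧
      EndpointGrowth h (c / (k + 1)) (k + 1) w v := by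
  have main : ∀ {h h' : ℝ → ℝ}, (∀ x ∈ Icc u v, HasDerivAt h (h' x) x) →
      EndpointGrowth h' c k u v → (∀ x ∈ Icc u v, 0 ≤ h' x) →
      ∃ w ∈ Icc u v, EndpointGrowth h (c / (k + 1)) (k + 1) u w ∧
        EndpointGrowth h (c / (k + 1)) (k + 1) w v := by
    intro h h' hd H hpos
    obtain ⟨w, hw, h1, h2⟩ := exists_constSign_split_of_hasDerivAt huv hd H.1
    have hle : (∀ x ∈ Icc u v, c * (x - u) ^ k ≤ h' x) ∨
        (∀ x ∈ Icc u v, c * (v - x) ^ k ≤ h' x) :=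
      H.2.imp (fun H x hx => by simpa [abs_of_nonneg (hpos x hx)] using H x hx)
        (fun H x hx => by simpa [abs_of_nonneg (hpos x hx)] using H x hx)
    have key : ∀ {y z : ℝ}, u ≤ y → y ≤ z → z ≤ v → ConstSign h (Icc y z) →
        EndpointGrowth h (c / (k + 1)) (k + 1) y z := by
      intro y z hy hyz hz hs
      refine ⟨hs, hs.imp (fun hs x hx => ?_) (fun hs x hx => ?_)⟩
      · rw [abs_of_nonneg (hs x hx)]
        have := le_sub_of_hasDerivAt_of_pow_le hc hd hle hy hx.1 (hx.2.trans hz)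
        linarith [hs y (left_mem_Icc.2 hyz)]
      · rw [abs_of_nonpos (hs x hx)]
        have := le_sub_of_hasDerivAt_of_pow_le hc hd hle (hy.trans hx.1) hx.2 hz
        linarith [hs z (right_mem_Icc.2 hyz)]
    exact ⟨w, hw, key le_rfl hw.1 hw.2 h1, key hw.1 hw.2 le_rfl h2⟩
  rcases H.1 with hpos | hneg
  · exact main hd H hpos
  · obtain ⟨w, hw, h1, h2⟩ := main (h := -h) (h' := -h') (fun x hx => (hd x hx).neg) H.neg
      (fun x hx => neg_nonneg.2 (hneg x hx))
    exact ⟨w, hw, by simpa using h1.neg, by simpa using h2.neg⟩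

theorem setLIntegral_le_of_endpointGrowth (F : ℝ → ℝ≥0∞) {U V : ℝ} (k : ℕ) :
    ∀ (g : ℕ → ℝ → ℝ) (c : ℝ) (K : ℝ≥0∞), 0 ≤ c →
      (∀ i, ∀ x ∈ Icc U V, HasDerivAt (g i) (g (i + 1) x) x) →
      (∀ u v, U ≤ u → u ≤ v → v ≤ V → EndpointGrowth (g 0) (c / k.factorial) k u v →
        ∫⁻ x in Icc u v, F x ≤ K) →
      ∀ u v, U ≤ u → u ≤ v → v ≤ V → EndpointGrowth (g k) c 0 u v →
        ∫⁻ x in Icc u v, F x ≤ 2 ^ k * K := by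
  induction k with
  | zero =>
    intro g c K _ _ h u v hu huv hv H
    simpa using h u v hu huv hv (by simpa using H)
  | succ k ih =>
    intro g c K hc hd h u v hu huv hv H
    rw [pow_succ, mul_assoc]
    refine ih (fun i => g (i + 1)) c (2 * K) hc (fun i => hd (i + 1)) ?_ u v hu huv hv H
    intro u v hu huv hv H
    have hsub : Icc u v ⊆ Icc U V := Icc_subset_Icc hu hv
    obtain ⟨w, hw, h1, h2⟩ := H.exists_split huv (by positivity) fun x hx => hd 0 x (hsub hx)
    have heq : c / k.factorial / (k + 1) = c / (k + 1).factorial := by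
      rw [Nat.factorial_succ]
      push_cast
      field_simp
    rw [heq] at h1 h2
    rw [← Icc_union_Icc_eq_Icc hw.1 hw.2, two_mul]
    exact (lintegral_union_le _ _ _).trans (add_le_add (h u w hu hw.1 (hw.2.trans hv) h1)
      (h w v (hu.trans hw.1) hw.2 hv h2))

theorem setLIntegral_rpow_neg_pow_lt_top {c r : ℝ} {k : ℕ} (hc : 0 < c) (hkr : k * r < 1)
    (L : ℝ) :
    ∫⁻ x in Icc 0 L, ENNReal.ofReal (c * x ^ k) ^ (-r) < ⊤ := by
  rcases lt_or_ge L 0 with hL | hL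
  · simp [Icc_eq_empty (not_le.2 hL)]
  have hint : IntegrableOn (fun x : ℝ => c ^ (-r) * x ^ (-(k * r))) (Ioc 0 L) := by
    have := (intervalIntegral.intervalIntegrable_rpow' (a := 0) (b := L)
      (r := -(k * r)) (by linarith)).const_mul (c ^ (-r))
    rwa [intervalIntegrable_iff_integrableOn_Ioc_of_le hL] at this
  rw [setLIntegral_congr Ioc_ae_eq_Icc.symm, setLIntegral_congr_fun (g := fun x =>
    ENNReal.ofReal (c ^ (-r) * x ^ (-(k * r)))) measurableSet_Ioc]
  · exact hint.setLIntegral_lt_top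
  · intro x hx
    have hx0 : 0 < x := hx.1
    simp only
    rw [ENNReal.ofReal_rpow_of_pos (by positivity), Real.mul_rpow hc.le (by positivity),
      ← Real.rpow_natCast, ← Real.rpow_mul hx0.le, mul_neg]

/-- If the `k`-th derivative of a function is bounded below by `c` on an interval, then its
negative power `-r` is integrable there when `k r < 1`, uniformly over all such functions. -/
theorem exists_setLIntegral_rpow_neg_le {c r : ℝ} {k : ℕ} (hc : 0 < c) (hr : 0 ≤ r)
    (hkr : k * r < 1) (L : ℝ) :
    ∃ C : ℝ≥0∞, C ≠ ⊤ ∧ ∀ (g : ℕ → ℝ → ℝ) (u v : ℝ), u ≤ v → v - u ≤ L →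
      (∀ i, ∀ x ∈ Icc u v, HasDerivAt (g i) (g (i + 1) x) x) →
      ((∀ x ∈ Icc u v, c ≤ g k x) ∨ (∀ x ∈ Icc u v, g k x ≤ -c)) →
      ∫⁻ x in Icc u v, ENNReal.ofReal |g 0 x| ^ (-r) ≤ C := by
  set c' : ℝ := c / k.factorial with hc'
  have hc'0 : 0 < c' := by positivity
  set G : ℝ → ℝ≥0∞ := (Icc 0 L).indicator fun x => ENNReal.ofReal (c' * x ^ k) ^ (-r) with hG
  set K : ℝ≥0∞ := ∫⁻ x, G x with hK
  have hKtop : K < ⊤ := by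
    rw [hK, hG, lintegral_indicator measurableSet_Icc]
    exact setLIntegral_rpow_neg_pow_lt_top hc'0 hkr L
  refine ⟨2 ^ k * K, ENNReal.mul_ne_top (by simp) hKtop.ne, fun g u v huv hL hd hk => ?_⟩
  refine setLIntegral_le_of_endpointGrowth _ k g c K hc.le hd ?_ u v le_rfl huv le_rfl
    ⟨hk.imp (fun h x hx => hc.le.trans (h x hx)) (fun h x hx => (h x hx).trans (by linarith)),
      Or.inl fun x hx => ?_⟩
  · intro y z hy hyz hz H
    have key : ∀ {s t : ℝ}, 0 ≤ s → s ≤ L → c' * s ^ k ≤ t → ENNReal.ofReal t ^ (-r) ≤ G s := by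
      intro s t hs hsL hst
      rw [hG, indicator_of_mem (show s ∈ Icc 0 L from ⟨hs, hsL⟩), ENNReal.rpow_neg,
        ENNReal.rpow_neg, ENNReal.inv_le_inv]
      exact ENNReal.rpow_le_rpow (ENNReal.ofReal_le_ofReal hst) hr
    rcases H.2 with H | H
    · calc ∫⁻ x in Icc y z, ENNReal.ofReal |g 0 x| ^ (-r)
          ≤ ∫⁻ x in Icc y z, G (x - y) := setLIntegral_mono' measurableSet_Icc fun x hx =>
            key (sub_nonneg.2 hx.1) (by linarith [hx.2]) (H x hx)
        _ ≤ ∫⁻ x, G (x - y) := setLIntegral_le_lintegral _ _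
        _ = K := lintegral_sub_right_eq_self G y
    · calc ∫⁻ x in Icc y z, ENNReal.ofReal |g 0 x| ^ (-r)
          ≤ ∫⁻ x in Icc y z, G (z - x) := setLIntegral_mono' measurableSet_Icc fun x hx =>
            key (sub_nonneg.2 hx.2) (by linarith [hx.1]) (H x hx)
        _ ≤ ∫⁻ x, G (z - x) := setLIntegral_le_lintegral _ _
        _ = K := lintegral_sub_left_eq_self G z
  · rw [pow_zero, mul_one]
    exact hk.elim (fun h => le_abs.2 (Or.inl (h x hx)))
      (fun h => le_abs.2 (Or.inr (by linarith [h x hx])))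

theorem isCompact_setOf_onS1 : IsCompact {ζ : Fin 2 → ℝ | onS1 ζ} := by
  refine (isCompact_Icc (a := (-1 : Fin 2 → ℝ)) (b := 1)).of_isClosed_subset ?_ fun ζ hζ => ?_
  · exact isClosed_eq (by fun_prop) (by fun_prop)
  · have h : ζ 0 ^ 2 + ζ 1 ^ 2 = 1 := hζ
    have h0 : |ζ 0| ≤ 1 := abs_le_one_iff_mul_self_le_one.2 (by nlinarith [sq_nonneg (ζ 1)])
    have h1 : |ζ 1| ≤ 1 := abs_le_one_iff_mul_self_le_one.2 (by nlinarith [sq_nonneg (ζ 0)])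
    rw [abs_le] at h0 h1
    simp only [mem_Icc, Pi.le_def, Fin.forall_fin_two, Pi.neg_apply, Pi.one_apply]
    exact ⟨⟨h0.1, h1.1⟩, h0.2, h1.2⟩

/-- A family of linear combinations of two functions is uniformly integrable to the power `-r` on a
compact interval as soon as zeros have order less than `1 / r`. -/
theorem exists_setLIntegral_dot2_rpow_neg_le {g : ℕ → ℝ → Fin 2 → ℝ} {a b c d r : ℝ}
    (hac : a < c) (hdb : d < b) (hr : 0 ≤ r)
    (hg : ∀ i j, ∀ s ∈ Ioo a b, HasDerivAt (fun s => g i s j) (g (i + 1) s j) s)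
    (hord : ∀ ζ, onS1 ζ → ∀ s ∈ Icc c d, ∃ k : ℕ, k * r < 1 ∧ dot2 (g k s) ζ ≠ 0) :
    ∃ C : ℝ≥0∞, C ≠ ⊤ ∧ ∀ ζ, onS1 ζ →
      ∫⁻ s in Icc c d, ENNReal.ofReal |dot2 (g 0 s) ζ| ^ (-r) ≤ C := by
  have hdot : ∀ ζ i, ∀ s ∈ Ioo a b,
      HasDerivAt (fun s => dot2 (g i s) ζ) (dot2 (g (i + 1) s) ζ) s := fun ζ i s hs =>
    ((hg i 0 s hs).mul_const _).add ((hg i 1 s hs).mul_const _)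
  let p : Set ((Fin 2 → ℝ) × ℝ) → Prop := fun S => ∃ C : ℝ≥0∞, C ≠ ⊤ ∧ ∀ ζ,
    ∫⁻ s in {s | (ζ, s) ∈ S}, ENNReal.ofReal |dot2 (g 0 s) ζ| ^ (-r) ≤ C
  have hp : p ({ζ | onS1 ζ} ×ˢ Icc c d) := by
    refine (isCompact_setOf_onS1.prod isCompact_Icc).induction_on (p := p) ⟨0, by simp, by simp⟩
      ?_ ?_ ?_
    · rintro S T hST ⟨C, hC, h⟩
      exact ⟨C, hC, fun ζ => (lintegral_mono_set (t := {s | (ζ, s) ∈ T}) fun s hs => hST hs).trans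
        (h ζ)⟩
    · rintro S T ⟨C, hC, h⟩ ⟨C', hC', h'⟩
      exact ⟨C + C', ENNReal.add_ne_top.2 ⟨hC, hC'⟩, fun ζ =>
        (lintegral_union_le _ {s | (ζ, s) ∈ S} {s | (ζ, s) ∈ T}).trans (add_le_add (h ζ) (h' ζ))⟩
    rintro ⟨ζ₀, s₀⟩ ⟨hζ₀, hs₀⟩
    obtain ⟨k, hkr, hne⟩ := hord ζ₀ hζ₀ s₀ hs₀
    have hs₀' : s₀ ∈ Ioo a b := ⟨hac.trans_le hs₀.1, hs₀.2.trans_lt hdb⟩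
    have hcont : ContinuousAt (fun z : (Fin 2 → ℝ) × ℝ => dot2 (g k z.2) z.1) (ζ₀, s₀) := by
      have hj : ∀ j, ContinuousAt (fun z : (Fin 2 → ℝ) × ℝ => g k z.2 j) (ζ₀, s₀) := fun j =>
        ContinuousAt.comp (f := Prod.snd) (g := fun s => g k s j)
          (hg k j s₀ hs₀').continuousAt continuousAt_snd
      have hz : ∀ j, ContinuousAt (fun z : (Fin 2 → ℝ) × ℝ => z.1 j) (ζ₀, s₀) := fun j => by
        fun_prop
      exact ((hj 0).mul (hz 0)).add ((hj 1).mul (hz 1))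
    set ε : ℝ := |dot2 (g k s₀) ζ₀| / 2 with hε
    have hε0 : 0 < ε := by
      have := abs_pos.2 hne
      positivity
    obtain ⟨ρ, hρ, hball⟩ := Metric.nhds_basis_closedBall.mem_iff.1
      (Filter.inter_mem (hcont (Metric.ball_mem_nhds _ hε0))
        ((continuousAt_snd : ContinuousAt Prod.snd (ζ₀, s₀)) (isOpen_Ioo.mem_nhds hs₀')))
    obtain ⟨C, hC, h⟩ := exists_setLIntegral_rpow_neg_le hε0 hr hkr (2 * ρ)
    refine ⟨Metric.closedBall (ζ₀, s₀) ρ, mem_nhdsWithin_of_mem_nhds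
      (Metric.closedBall_mem_nhds _ hρ), C, hC, fun ζ => ?_⟩
    by_cases hζ : dist ζ ζ₀ ≤ ρ
    · have hmem : ∀ s ∈ Icc (s₀ - ρ) (s₀ + ρ), (ζ, s) ∈ Metric.closedBall (ζ₀, s₀) ρ := by
        intro s hs
        rw [Metric.mem_closedBall, Prod.dist_eq]
        exact max_le hζ (by rw [Real.dist_eq, abs_le]; constructor <;> linarith [hs.1, hs.2])
      refine (lintegral_mono_set (t := Icc (s₀ - ρ) (s₀ + ρ)) fun s hs => ?_).trans
        (h (fun i s => dot2 (g i s) ζ) (s₀ - ρ) (s₀ + ρ) (by linarith) (by linarith)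
          (fun i s hs => hdot ζ i s (hball (hmem s hs)).2) ?_)
      · have : dist s s₀ ≤ ρ := (le_max_right _ _).trans (Metric.mem_closedBall.1 hs)
        rw [Real.dist_eq, abs_le] at this
        constructor <;> linarith [this.1, this.2]
      · have hv : ∀ s ∈ Icc (s₀ - ρ) (s₀ + ρ),
            |dot2 (g k s) ζ - dot2 (g k s₀) ζ₀| < ε := fun s hs =>
          (hball (hmem s hs)).1
        rcases lt_or_gt_of_ne hne with hneg | hpos
        · rw [abs_of_neg hneg] at hε
          exact Or.inr fun s hs => by linarith [(abs_lt.1 (hv s hs)).2]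
        · rw [abs_of_pos hpos] at hε
          exact Or.inl fun s hs => by linarith [(abs_lt.1 (hv s hs)).1]
    · have : {s | (ζ, s) ∈ Metric.closedBall (ζ₀, s₀) ρ} = ∅ :=
        eq_empty_of_forall_notMem fun s hs =>
          hζ ((le_max_left _ _).trans (Metric.mem_closedBall.1 hs))
      rw [this]
      simp
  obtain ⟨C, hC, h⟩ := hp
  refine ⟨C, hC, fun ζ hζ => (lintegral_mono_set fun s hs => ?_).trans (h ζ)⟩
  exact ⟨hζ, hs⟩

theorem abs_le_mul_pow_of_hasDerivAt {g : ℕ → ℝ → ℝ} {s₀ ρ B : ℝ} {n : ℕ}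
    (hd : ∀ i, ∀ s ∈ Icc (s₀ - ρ) (s₀ + ρ), HasDerivAt (g i) (g (i + 1) s) s)
    (hB : ∀ s ∈ Icc (s₀ - ρ) (s₀ + ρ), |g n s| ≤ B) (h0 : ∀ i < n, g i s₀ = 0) (i : ℕ) :
    ∀ j, j + i = n → ∀ s ∈ Icc (s₀ - ρ) (s₀ + ρ), |g j s| ≤ B * |s - s₀| ^ i := by
  induction i with
  | zero =>
    rintro j rfl s hs
    simpa using hB s hs
  | succ i ih =>
    intro j hj s hs
    have hρ : 0 ≤ ρ := by linarith [hs.1, hs.2]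
    have hs₀ : s₀ ∈ Icc (s₀ - ρ) (s₀ + ρ) := ⟨by linarith, by linarith⟩
    have hB0 : 0 ≤ B := (abs_nonneg _).trans (hB s hs)
    have hsub : uIcc s₀ s ⊆ Icc (s₀ - ρ) (s₀ + ρ) := uIcc_subset_Icc hs₀ hs
    have := (convex_uIcc s₀ s).norm_image_sub_le_of_norm_hasDerivWithin_le
      (f := g j) (f' := g (j + 1)) (C := B * |s - s₀| ^ i)
      (fun x hx => (hd j x (hsub hx)).hasDerivWithinAt)
      (fun x hx => (ih (j + 1) (by omega) x (hsub hx)).trans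
        (by gcongr ?_ * ?_ ^ _; simpa using abs_sub_left_of_mem_uIcc hx)) left_mem_uIcc right_mem_uIcc
    rw [h0 j (by omega), sub_zero, Real.norm_eq_abs, Real.norm_eq_abs] at this
    rwa [pow_succ, ← mul_assoc]

/-- If `g` vanishes to order `k ≥ 3` at `s₀`, then the quadratic expression
`A g g'' + B s g' g'' + C g' ^ 2` vanishes at least to order `2 k - 3`. -/
theorem exists_abs_quadratic_le {g : ℕ → ℝ → ℝ} {s₀ ρ : ℝ} {k : ℕ} (hρ : 0 < ρ) (hk : 3 ≤ k)
    (hd : ∀ i, ∀ s ∈ Icc (s₀ - ρ) (s₀ + ρ), HasDerivAt (g i) (g (i + 1) s) s)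
    (h0 : ∀ i < k, g i s₀ = 0) (A B C : ℝ) :
    ∃ E : ℝ, 0 ≤ E ∧ ∀ s, |s - s₀| ≤ ρ → |s - s₀| ≤ 1 →
      |A * (g 0 s * g 2 s) + B * (s * (g 1 s * g 2 s)) + C * g 1 s ^ 2| ≤
        E * |s - s₀| ^ (2 * k - 3) := by
  obtain ⟨N, hN⟩ := (isCompact_Icc (a := s₀ - ρ) (b := s₀ + ρ)).exists_bound_of_continuousOn
    (f := g k) fun s hs => (hd k s hs).continuousAt.continuousWithinAt
  have hN0 : 0 ≤ N := (norm_nonneg _).trans (hN s₀ ⟨by linarith, by linarith⟩)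
  refine ⟨(|A| + |B| * (|s₀| + 1) + |C|) * N ^ 2, by positivity, fun s hsρ hs1 => ?_⟩
  have hs : s ∈ Icc (s₀ - ρ) (s₀ + ρ) := by
    rw [abs_le] at hsρ
    constructor <;> linarith [hsρ.1, hsρ.2]
  obtain ⟨k, rfl⟩ := Nat.exists_eq_add_of_le hk
  have hx0 := abs_nonneg (s - s₀)
  have b0 := abs_le_mul_pow_of_hasDerivAt hd hN h0 (3 + k) 0 (by omega) s hs
  have b1 := abs_le_mul_pow_of_hasDerivAt hd hN h0 (2 + k) 1 (by omega) s hs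
  have b2 := abs_le_mul_pow_of_hasDerivAt hd hN h0 (1 + k) 2 (by omega) s hs
  set x := |s - s₀| with hx
  have hsabs : |s| ≤ |s₀| + 1 := by
    have := abs_add_le (s - s₀) s₀
    rw [sub_add_cancel] at this
    linarith
  have hpow : ∀ n, 3 + 2 * k ≤ n → x ^ n ≤ x ^ (2 * (3 + k) - 3) := fun n hn =>
    pow_le_pow_of_le_one hx0 hs1 (by omega)
  have e02 : |g 0 s * g 2 s| ≤ N ^ 2 * x ^ (2 * (3 + k) - 3) := by
    rw [abs_mul]
    calc |g 0 s| * |g 2 s| ≤ (N * x ^ (3 + k)) * (N * x ^ (1 + k)) := by gcongr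
      _ = N ^ 2 * x ^ (4 + 2 * k) := by ring
      _ ≤ _ := mul_le_mul_of_nonneg_left (hpow _ (by omega)) (sq_nonneg N)
  have e12 : |g 1 s * g 2 s| ≤ N ^ 2 * x ^ (2 * (3 + k) - 3) := by
    rw [abs_mul]
    calc |g 1 s| * |g 2 s| ≤ (N * x ^ (2 + k)) * (N * x ^ (1 + k)) := by gcongr
      _ = N ^ 2 * x ^ (3 + 2 * k) := by ring
      _ ≤ _ := mul_le_mul_of_nonneg_left (hpow _ (by omega)) (sq_nonneg N)
  have e11 : |g 1 s ^ 2| ≤ N ^ 2 * x ^ (2 * (3 + k) - 3) := by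
    rw [abs_pow]
    calc |g 1 s| ^ 2 ≤ (N * x ^ (2 + k)) ^ 2 := by gcongr
      _ = N ^ 2 * x ^ (4 + 2 * k) := by ring
      _ ≤ _ := mul_le_mul_of_nonneg_left (hpow _ (by omega)) (sq_nonneg N)
  set X := N ^ 2 * x ^ (2 * (3 + k) - 3) with hX
  have hX0 : 0 ≤ X := by positivity
  calc |A * (g 0 s * g 2 s) + B * (s * (g 1 s * g 2 s)) + C * g 1 s ^ 2|
      ≤ |A| * |g 0 s * g 2 s| + |B| * (|s| * |g 1 s * g 2 s|) + |C| * |g 1 s ^ 2| := by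
        refine (abs_add_le _ _).trans (add_le_add ((abs_add_le _ _).trans (add_le_add ?_ ?_)) ?_) <;>
          simp only [abs_mul, le_refl]
    _ ≤ |A| * X + |B| * ((|s₀| + 1) * X) + |C| * X := by gcongr
    _ = _ := by rw [hX]; ring

/-- The function of two variables, homogeneous of degree `κ` with respect to the dilations
`(t, t ^ τ)`, whose restriction to the line `x₁ = 1` is `g`. -/
def homogeneousExtension (τ κ : ℝ) (g : ℝ → ℝ) (y : Fin 2 → ℝ) : ℝ :=
  y 0 ^ κ * g (y 1 * y 0 ^ (-τ))

theorem fderiv_homogeneousExtension {τ κ g' : ℝ} {g : ℝ → ℝ} {y : Fin 2 → ℝ} (hy : 0 < y 0)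
    (hg : HasDerivAt g g' (y 1 * y 0 ^ (-τ))) :
    fderiv ℝ (homogeneousExtension τ κ g) y (Pi.single 0 1) =
        y 0 ^ (κ - 1) * (κ * g (y 1 * y 0 ^ (-τ)) - τ * (y 1 * y 0 ^ (-τ) * g')) ∧
      fderiv ℝ (homogeneousExtension τ κ g) y (Pi.single 1 1) = y 0 ^ (κ - τ) * g' := by
  have h0 : HasFDerivAt (fun y : Fin 2 → ℝ => y 0)
      (ContinuousLinearMap.proj (R := ℝ) (φ := fun _ : Fin 2 => ℝ) 0) y :=
    hasFDerivAt_apply 0 y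
  have h1 : HasFDerivAt (fun y : Fin 2 → ℝ => y 1)
      (ContinuousLinearMap.proj (R := ℝ) (φ := fun _ : Fin 2 => ℝ) 1) y :=
    hasFDerivAt_apply 1 y
  have hκ := h0.rpow_const (p := κ) (Or.inl hy.ne')
  have hτ := h0.rpow_const (p := -τ) (Or.inl hy.ne')
  have h := (hκ.mul (hg.comp_hasFDerivAt y (h1.mul hτ))).fderiv
  have e1 : y 0 ^ κ = y 0 ^ (κ - 1) * y 0 := by
    rw [← Real.rpow_add_one hy.ne', sub_add_cancel]
  have e2 : y 0 ^ (-τ) = y 0 ^ (-τ - 1) * y 0 := by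
    rw [← Real.rpow_add_one hy.ne', sub_add_cancel]
  have e3 : y 0 ^ (κ - τ) = y 0 ^ κ * y 0 ^ (-τ) := by
    rw [← Real.rpow_add hy, sub_eq_add_neg]
  have h' : fderiv ℝ (homogeneousExtension τ κ g) y = _ := h
  rw [h']
  constructor
  · simp
    rw [e1, e2]
    ring
  · simp
    rw [e3]
    ring

theorem Hess_eq_of_eventuallyEq {τ κ a b s : ℝ} {g : ℕ → ℝ → ℝ} {f : (Fin 2 → ℝ) → ℝ}
    (hs : s ∈ Ioo a b) (hg : ∀ i, ∀ s ∈ Ioo a b, HasDerivAt (g i) (g (i + 1) s) s)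
    (hf : f =ᶠ[nhds ![1, s]] homogeneousExtension τ κ (g 0)) :
    Hess f ![1, s] =
      !![(κ - 1) * (κ * g 0 s - τ * (s * g 1 s)) - τ * (s * ((κ - τ) * g 1 s - τ * (s * g 2 s))),
        (κ - τ) * g 1 s - τ * (s * g 2 s);
        (κ - τ) * g 1 s - τ * (s * g 2 s), g 2 s] := by
  have hW : ∀ᶠ y : Fin 2 → ℝ in nhds ![1, s], 0 < y 0 ∧ y 1 * y 0 ^ (-τ) ∈ Ioo a b := by
    have c0 : ContinuousAt (fun y : Fin 2 → ℝ => y 0) ![1, s] := (continuous_apply 0).continuousAt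
    have c1 : ContinuousAt (fun y : Fin 2 → ℝ => y 1 * y 0 ^ (-τ)) ![1, s] :=
      (continuous_apply (1 : Fin 2)).continuousAt.mul
        (c0.rpow_const (Or.inl (by simp)))
    exact (c0.eventually (isOpen_Ioi.mem_nhds (by simp))).and
      (c1.eventually (isOpen_Ioo.mem_nhds (by simpa using hs)))
  have hd : ∀ u ∈ Ioo a b, HasDerivAt (fun u => κ * g 0 u - τ * (u * g 1 u))
      ((κ - τ) * g 1 u - τ * (u * g 2 u)) u := fun u hu =>
    (((hg 0 u hu).const_mul κ).sub (((hasDerivAt_id u).mul (hg 1 u hu)).const_mul τ)).congr_deriv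
      (by simp only [zero_add, one_add_one_eq_two, id_eq]; ring)
  have f0 : (fun y => fderiv ℝ f y (Pi.single 0 1)) =ᶠ[nhds ![1, s]]
      homogeneousExtension τ (κ - 1) fun u => κ * g 0 u - τ * (u * g 1 u) := by
    filter_upwards [hf.eventuallyEq_nhds, hW] with y hy hyW
    rw [hy.fderiv_eq, (fderiv_homogeneousExtension hyW.1 (hg 0 _ hyW.2)).1]
    rfl
  have f1 : (fun y => fderiv ℝ f y (Pi.single 1 1)) =ᶠ[nhds ![1, s]]
      homogeneousExtension τ (κ - τ) (g 1) := by
    filter_upwards [hf.eventuallyEq_nhds, hW] with y hy hyW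
    rw [hy.fderiv_eq, (fderiv_homogeneousExtension hyW.1 (hg 0 _ hyW.2)).2]
    rfl
  have hy0 : (0 : ℝ) < (![1, s] : Fin 2 → ℝ) 0 := by simp
  have hu : (![1, s] : Fin 2 → ℝ) 1 * (![1, s] : Fin 2 → ℝ) 0 ^ (-τ) = s := by simp
  have r0 := fderiv_homogeneousExtension (τ := τ) (κ := κ - 1) hy0 (hd _ (by rwa [hu]))
  have r1 := fderiv_homogeneousExtension (τ := τ) (κ := κ - τ) hy0 (hg 1 _ (by rwa [hu]))
  rw [← f0.fderiv_eq, hu] at r0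
  rw [← f1.fderiv_eq, hu] at r1
  ext i j
  fin_cases i <;> fin_cases j
  · simpa [Hess] using r0.1
  · simpa [Hess] using r1.1
  · simpa [Hess] using r0.2
  · simpa [Hess] using r1.2

theorem eq_dil_of_pos {α₁ α₂ : ℝ} (hα₁ : 0 < α₁) {y : Fin 2 → ℝ} (hy : 0 < y 0) :
    y = dil α₁ α₂ (y 0 ^ α₁⁻¹) ![1, y 1 * y 0 ^ (-(α₂ / α₁))] := by
  ext i
  fin_cases i
  · simp [dil, ← Real.rpow_mul hy.le, hα₁.ne']
  · simp only [dil, Fin.mk_one, Matrix.cons_val_one, Matrix.cons_val_fin_one]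
    rw [← Real.rpow_mul hy.le, mul_left_comm, ← Real.rpow_add hy, inv_mul_eq_div]
    simp

theorem eventuallyEq_homogeneousExtension {α₁ α₂ m a b s : ℝ} {φ : (Fin 2 → ℝ) → Fin 2 → ℝ}
    (hα₁ : 0 < α₁)
    (hφ : ∀ x ∈ Vab α₁ α₂ a b, ∀ t : ℝ, 0 < t → φ (dil α₁ α₂ t x) = t ^ m • φ x)
    (hs : s ∈ Ioo a b) (i : Fin 2) :
    (fun y => φ y i) =ᶠ[nhds ![1, s]]
      homogeneousExtension (α₂ / α₁) (m / α₁) fun u => φ ![1, u] i := by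
  have c0 : ContinuousAt (fun y : Fin 2 → ℝ => y 0) ![1, s] := (continuous_apply 0).continuousAt
  have c1 : ContinuousAt (fun y : Fin 2 → ℝ => y 1 * y 0 ^ (-(α₂ / α₁))) ![1, s] :=
    (continuous_apply (1 : Fin 2)).continuousAt.mul
      (c0.rpow_const (Or.inl (by simp)))
  filter_upwards [c0.eventually (isOpen_Ioi.mem_nhds (by simp : (0 : ℝ) < _)),
    c1.eventually (isOpen_Ioo.mem_nhds (by simpa using hs))] with y hy0 hy1
  have hmem : (![1, y 1 * y 0 ^ (-(α₂ / α₁))] : Fin 2 → ℝ) ∈ Vab α₁ α₂ a b :=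
    ⟨_, 1, hy1.1, hy1.2, one_pos, by ext i; fin_cases i <;> simp [dil]⟩
  have h := hφ _ hmem (y 0 ^ α₁⁻¹) (Real.rpow_pos_of_pos hy0 _)
  rw [← eq_dil_of_pos hα₁ hy0, ← Real.rpow_mul (le_of_lt hy0), inv_mul_eq_div] at h
  rw [h]
  rfl

/-- The form `Q` at `(1, s)` in terms of the function `⟨φ(1, s), ζ⟩` and its derivatives. -/
theorem Qform_eq {α₁ α₂ m a b s : ℝ} {φ : (Fin 2 → ℝ) → Fin 2 → ℝ} {g : ℕ → ℝ → Fin 2 → ℝ}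
    (hα₁ : 0 < α₁)
    (hφ : ∀ x ∈ Vab α₁ α₂ a b, ∀ t : ℝ, 0 < t → φ (dil α₁ α₂ t x) = t ^ m • φ x)
    (hg0 : ∀ s, g 0 s = φ ![1, s])
    (hg : ∀ i j, ∀ s ∈ Ioo a b, HasDerivAt (fun s => g i s j) (g (i + 1) s j) s)
    (hs : s ∈ Ioo a b) (ζ : Fin 2 → ℝ) :
    Qform φ ![1, s] ζ = m / α₁ * (m / α₁ - 1) * (dot2 (g 0 s) ζ * dot2 (g 2 s) ζ) +
      (α₂ / α₁ - (α₂ / α₁) ^ 2) * (s * (dot2 (g 1 s) ζ * dot2 (g 2 s) ζ)) +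
      -(m / α₁ - α₂ / α₁) ^ 2 * dot2 (g 1 s) ζ ^ 2 := by
  have hH : ∀ j, Hess (fun y => φ y j) ![1, s] = _ := fun j =>
    Hess_eq_of_eventuallyEq (g := fun i s => g i s j) (τ := α₂ / α₁) (κ := m / α₁) hs
      (fun i s hs => hg i j s hs)
      (by simpa only [hg0] using eventuallyEq_homogeneousExtension hα₁ hφ hs j)
  rw [Qform, hH, hH, Matrix.det_fin_two]
  simp [dot2]
  ring

theorem exists_mul_pow_lt_mul_pow {D E ε : ℝ} {n N : ℕ} (hD : 0 < D) (hE : 0 ≤ E) (hε : 0 < ε)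
    (hn : n < N) : ∃ x, 0 < x ∧ x < ε ∧ E * x ^ N < D * x ^ n := by
  have hx : 0 < min (min (ε / 2) 1) (D / (2 * (E + 1))) := by positivity
  set x := min (min (ε / 2) 1) (D / (2 * (E + 1)))
  have hx1 : x ≤ 1 := (min_le_left _ _).trans (min_le_right _ _)
  have hxε : x ≤ ε / 2 := (min_le_left _ _).trans (min_le_left _ _)
  have hxD : x * (2 * (E + 1)) ≤ D := (le_div_iff₀ (by positivity)).1 (min_le_right _ _)
  refine ⟨x, hx, by linarith, ?_⟩
  calc E * x ^ N ≤ E * x ^ (n + 1) :=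
        mul_le_mul_of_nonneg_left (pow_le_pow_of_le_one hx.le hx1 hn) hE
    _ = E * x * x ^ n := by ring
    _ < D * x ^ n := mul_lt_mul_of_pos_right (by nlinarith) (pow_pos hx n)

theorem dil_one (α₁ α₂ : ℝ) (x : Fin 2 → ℝ) : dil α₁ α₂ 1 x = x := by
  ext i
  fin_cases i <;> simp [dil]

theorem mem_closure_Vab {α₁ α₂ c d s : ℝ} (hcd : c < d) (hs : s ∈ Icc c d) :
    (![1, s] : Fin 2 → ℝ) ∈ closure (Vab α₁ α₂ c d) := by
  rw [← closure_Ioo hcd.ne] at hs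
  exact map_mem_closure (f := fun s : ℝ => (![1, s] : Fin 2 → ℝ)) (by fun_prop) hs
    fun u hu => ⟨u, 1, hu.1, hu.2, one_pos, (dil_one _ _ _).symm⟩

theorem elliptic_of_ne {α₁ α₂ c d σ s : ℝ} {φ : (Fin 2 → ℝ) → Fin 2 → ℝ} (hα₁ : 0 < α₁)
    (hcd : c < d)
    (hell : {x | x ∈ closure (Vab α₁ α₂ c d) ∧ x ≠ 0 ∧ ¬ Elliptic φ x}
        = {x | ∃ t : ℝ, 0 < t ∧ x = dil α₁ α₂ t ![1, σ]})
    (hs : s ∈ Icc c d) (hne : s ≠ σ) : Elliptic φ ![1, s] := by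
  by_contra h
  have hmem : (![1, s] : Fin 2 → ℝ) ∈
      {x | x ∈ closure (Vab α₁ α₂ c d) ∧ x ≠ 0 ∧ ¬ Elliptic φ x} :=
    ⟨mem_closure_Vab hcd hs, fun h0 => by simpa using congrFun h0 0, h⟩
  rw [hell] at hmem
  obtain ⟨t, ht, he⟩ := hmem
  have h0 := congrFun he 0
  have h1 := congrFun he 1
  simp only [dil, Matrix.cons_val_zero, Matrix.cons_val_one, Matrix.cons_val_fin_one,
    mul_one] at h0 h1
  rw [← Real.one_rpow α₁, Real.rpow_left_inj zero_le_one ht.le hα₁.ne'] at h0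
  subst h0
  exact hne (by simpa using h1)

/-- If `Q` at `(1, s)` is nonzero or vanishes to low order at `s`, then for every `ζ` in the unit
circle the function `⟨φ(1, s), ζ⟩` vanishes to order less than `m / (α₁ + α₂)`. -/
theorem exists_dot2_ne_zero {α₁ α₂ m a b s₀ : ℝ} {φ : (Fin 2 → ℝ) → Fin 2 → ℝ}
    {g : ℕ → ℝ → Fin 2 → ℝ} (hα₁ : 0 < α₁) (hα₂ : 0 < α₂) (hm : 3 * (α₁ + α₂) ≤ m)
    (hφ : ∀ x ∈ Vab α₁ α₂ a b, ∀ t : ℝ, 0 < t → φ (dil α₁ α₂ t x) = t ^ m • φ x)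
    (hg0 : ∀ s, g 0 s = φ ![1, s])
    (hg : ∀ i j, ∀ s ∈ Ioo a b, HasDerivAt (fun s => g i s j) (g (i + 1) s j) s)
    (hs₀ : s₀ ∈ Ioo a b)
    (hQ : Elliptic φ ![1, s₀] ∨ ∃ n : ℕ, (n : ℝ) < 2 * m / (α₁ + α₂) - 3 ∧ ∃ D δ : ℝ, 0 < D ∧
      0 < δ ∧ ((∀ s ∈ Ioo (s₀ - δ) s₀, ∀ ζ, onS1 ζ → D * |s - s₀| ^ n ≤ |Qform φ ![1, s] ζ|) ∨
        ∀ s ∈ Ioo s₀ (s₀ + δ), ∀ ζ, onS1 ζ → D * |s - s₀| ^ n ≤ |Qform φ ![1, s] ζ|))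
    {ζ : Fin 2 → ℝ} (hζ : onS1 ζ) :
    ∃ k : ℕ, k * ((α₁ + α₂) / m) < 1 ∧ dot2 (g k s₀) ζ ≠ 0 := by
  by_contra! hzero
  have hA : 0 < α₁ + α₂ := by positivity
  have hm0 : 0 < m := by linarith
  have hM : 3 ≤ m / (α₁ + α₂) := (le_div_iff₀ hA).2 hm
  set K := ⌈m / (α₁ + α₂)⌉₊ with hK
  have hMK : m / (α₁ + α₂) ≤ K := Nat.le_ceil _
  have hK3 : 3 ≤ K := by exact_mod_cast hM.trans hMK
  have h0 : ∀ i < K, dot2 (g i s₀) ζ = 0 := fun i hi => by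
    refine hzero i ?_
    rw [← mul_div_assoc, div_lt_one hm0]
    exact (lt_div_iff₀ hA).1 (Nat.lt_ceil.1 hi)
  obtain ⟨ρ, hρ, hball⟩ := Metric.nhds_basis_closedBall.mem_iff.1 (isOpen_Ioo.mem_nhds hs₀)
  rw [Real.closedBall_eq_Icc] at hball
  obtain ⟨E, hE0, hE⟩ := exists_abs_quadratic_le (g := fun i s => dot2 (g i s) ζ) hρ hK3
    (fun i s hs => ((hg i 0 s (hball hs)).mul_const _).add ((hg i 1 s (hball hs)).mul_const _))
    h0 (m / α₁ * (m / α₁ - 1)) (α₂ / α₁ - (α₂ / α₁) ^ 2) (-(m / α₁ - α₂ / α₁) ^ 2)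
  have hbound : ∀ s, |s - s₀| ≤ ρ → |s - s₀| ≤ 1 →
      |Qform φ ![1, s] ζ| ≤ E * |s - s₀| ^ (2 * K - 3) := fun s hs hs1 => by
    have hs' : s ∈ Ioo a b := hball (by
      rw [abs_le] at hs
      constructor <;> linarith [hs.1, hs.2])
    rw [Qform_eq hα₁ hφ hg0 hg hs']
    exact hE s hs hs1
  rcases hQ with ⟨ε, hε, hell⟩ | ⟨n, hn, D, δ, hD, hδ, hQ⟩
  · have := (hell ζ hζ).trans (hbound s₀ (by simpa using hρ.le) (by simp))
    rw [sub_self, abs_zero, zero_pow (by omega), mul_zero] at this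
    linarith
  · have hnK : n < 2 * K - 3 := by
      have h2 : (n : ℝ) < 2 * K - 3 := by
        rw [mul_div_assoc] at hn
        linarith
      have h3 : (n : ℝ) + 3 < 2 * K := by linarith
      have h4 : n + 3 < 2 * K := by exact_mod_cast h3
      omega
    obtain ⟨x, hx0, hxε, hx⟩ := exists_mul_pow_lt_mul_pow (ε := min (min ρ 1) δ) hD hE0
      (by positivity) hnK
    have hxδ : x < δ := hxε.trans_le (min_le_right _ _)
    have hxρ : x ≤ ρ := hxε.le.trans ((min_le_left _ _).trans (min_le_left _ _))
    have hx1 : x ≤ 1 := hxε.le.trans ((min_le_left _ _).trans (min_le_right _ _))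
    have key : ∀ s, |s - s₀| = x → ¬ D * |s - s₀| ^ n ≤ |Qform φ ![1, s] ζ| := fun s hs h => by
      have := h.trans (hbound s (hs.trans_le hxρ) (hs.trans_le hx1))
      rw [hs] at this
      linarith
    rcases hQ with hQ | hQ
    · exact key (s₀ - x) (by simp [abs_of_pos hx0])
        (hQ _ ⟨by linarith, by linarith⟩ ζ hζ)
    · exact key (s₀ + x) (by simp [abs_of_pos hx0])
        (hQ _ ⟨by linarith, by linarith⟩ ζ hζ)

theorem dil_eq_rpow {α₁ α₂ t : ℝ} (hα : α₁ + α₂ ≠ 0) (ht : 0 ≤ t) (s : ℝ) :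
    dil α₁ α₂ t ![1, s] = ![(t ^ (α₁ + α₂)) ^ (α₁ / (α₁ + α₂)),
      s * (t ^ (α₁ + α₂)) ^ (α₂ / (α₁ + α₂))] := by
  rw [← Real.rpow_mul ht, ← Real.rpow_mul ht, mul_div_cancel₀ _ hα, mul_div_cancel₀ _ hα]
  ext i
  fin_cases i <;> simp [dil, mul_comm]

theorem rpow_mem_V1 {α₁ α₂ c d s v : ℝ} (hα : 0 < α₁ + α₂) (hs : s ∈ Ioo c d)
    (hv : v ∈ Ioo (0 : ℝ) 1) :
    ![v ^ (α₁ / (α₁ + α₂)), s * v ^ (α₂ / (α₁ + α₂))] ∈ V1 α₁ α₂ c d := by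
  refine ⟨s, v ^ (α₁ + α₂)⁻¹, hs.1, hs.2, Real.rpow_pos_of_pos hv.1 _,
    Real.rpow_lt_one hv.1.le hv.2 (by positivity), ?_⟩
  rw [dil_eq_rpow hα.ne' (Real.rpow_nonneg hv.1.le _), Real.rpow_inv_rpow hv.1.le hα.ne']

/-- Weighted polar coordinates on `V₁^{c,d}`, normalised to have constant Jacobian. -/
theorem setIntegral_V1_eq {α₁ α₂ : ℝ} (hα₁ : 0 < α₁) (hα₂ : 0 < α₂) (c d : ℝ)
    (f : (Fin 2 → ℝ) → ℂ) :
    ∫ x in V1 α₁ α₂ c d, f x = (α₁ / (α₁ + α₂)) •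
      ∫ z in Ioo c d ×ˢ Ioo (0 : ℝ) 1,
        f ![z.2 ^ (α₁ / (α₁ + α₂)), z.1 * z.2 ^ (α₂ / (α₁ + α₂))] := by
  have hA : 0 < α₁ + α₂ := by positivity
  set p := α₁ / (α₁ + α₂) with hp
  set q := α₂ / (α₁ + α₂) with hq
  have hp0 : 0 < p := by positivity
  have hpq : p + q = 1 := by
    rw [hp, hq]
    field_simp
  let T : (Fin 2 → ℝ) → Fin 2 → ℝ := fun y => ![y 1 ^ p, y 0 * y 1 ^ q]
  let S : Set (Fin 2 → ℝ) := MeasurableEquiv.finTwoArrow ⁻¹' (Ioo c d ×ˢ Ioo (0 : ℝ) 1)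
  have hS : ∀ y, y ∈ S ↔ y 0 ∈ Ioo c d ∧ y 1 ∈ Ioo (0 : ℝ) 1 := fun y => Iff.rfl
  have hSm : MeasurableSet S :=
    MeasurableEquiv.finTwoArrow.measurable (measurableSet_Ioo.prod measurableSet_Ioo)
  have himage : T '' S = V1 α₁ α₂ c d := by
    ext x
    constructor
    · rintro ⟨y, hy, rfl⟩
      exact rpow_mem_V1 hA ((hS y).1 hy).1 ((hS y).1 hy).2
    · rintro ⟨s, t, hc, hd, h0, h1, rfl⟩
      refine ⟨![s, t ^ (α₁ + α₂)], (hS _).2 ⟨⟨hc, hd⟩, Real.rpow_pos_of_pos h0 _,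
        Real.rpow_lt_one h0.le h1 hA⟩, ?_⟩
      rw [dil_eq_rpow hA.ne' h0.le]
      simp [T, hp, hq]
  have hinj : InjOn T S := by
    intro y hy z hz h
    have h0 : y 1 ^ p = z 1 ^ p := congrFun h 0
    have h1 : y 0 * y 1 ^ q = z 0 * z 1 ^ q := congrFun h 1
    have e1 : y 1 = z 1 := (Real.rpow_left_inj hy.2.1.le hz.2.1.le hp0.ne').1 h0
    rw [e1] at h1
    have e0 := mul_right_cancel₀ (Real.rpow_pos_of_pos hz.2.1 q).ne' h1
    ext i
    fin_cases i
    exacts [e0, e1]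
  let T' : (Fin 2 → ℝ) → (Fin 2 → ℝ) →L[ℝ] Fin 2 → ℝ := fun y =>
    ContinuousLinearMap.pi
      ![(p * y 1 ^ (p - 1)) • ContinuousLinearMap.proj (R := ℝ) (φ := fun _ : Fin 2 => ℝ) 1,
        y 0 • ((q * y 1 ^ (q - 1)) •
          ContinuousLinearMap.proj (R := ℝ) (φ := fun _ : Fin 2 => ℝ) 1) +
        y 1 ^ q • ContinuousLinearMap.proj (R := ℝ) (φ := fun _ : Fin 2 => ℝ) 0]
  have hT' : ∀ y ∈ S, HasFDerivWithinAt T (T' y) S y := fun y hy => by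
    have h0 : HasFDerivAt (fun y : Fin 2 → ℝ => y 0)
        (ContinuousLinearMap.proj (R := ℝ) (φ := fun _ : Fin 2 => ℝ) 0) y := hasFDerivAt_apply 0 y
    have h1 : HasFDerivAt (fun y : Fin 2 → ℝ => y 1)
        (ContinuousLinearMap.proj (R := ℝ) (φ := fun _ : Fin 2 => ℝ) 1) y := hasFDerivAt_apply 1 y
    have hy0 : y 1 ≠ 0 := hy.2.1.ne'
    refine (hasFDerivAt_pi'' fun i => ?_).hasFDerivWithinAt
    fin_cases i
    · exact h1.rpow_const (Or.inl hy0)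
    · exact h0.mul (h1.rpow_const (Or.inl hy0))
  have hdet : ∀ y ∈ S, |(T' y).det| = p := fun y hy => by
    have hy1 : 0 < y 1 := hy.2.1
    have h : y 1 ^ (p - 1) * y 1 ^ q = 1 := by
      rw [← Real.rpow_add hy1, show p - 1 + q = 0 by linarith, Real.rpow_zero]
    rw [ContinuousLinearMap.det, ← LinearMap.det_toMatrix', Matrix.det_fin_two]
    simp [T', LinearMap.toMatrix'_apply, -abs_mul]
    rw [mul_assoc, h, mul_one, abs_of_pos hp0]
  rw [← himage, integral_image_eq_integral_abs_det_fderiv_smul volume hSm hT' hinj,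
    setIntegral_congr_fun hSm (fun y hy => by simp only [hdet y hy] :
      EqOn _ (fun y => p • f (T y)) S), integral_smul,
    ← (volume_preserving_finTwoArrow ℝ).setIntegral_preimage_emb
      MeasurableEquiv.finTwoArrow.measurableEmbedding]
  rfl

theorem enorm_setIntegral_V1_le {α₁ α₂ c d : ℝ} {f : (Fin 2 → ℝ) → ℂ} (hα₁ : 0 < α₁)
    (hα₂ : 0 < α₂) (hf : ContinuousOn f (V1 α₁ α₂ c d)) (hf1 : ∀ x, ‖f x‖ ≤ 1) :
    ‖∫ x in V1 α₁ α₂ c d, f x‖ₑ ≤ ENNReal.ofReal (α₁ / (α₁ + α₂)) *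
      ∫⁻ s in Ioo c d, ‖∫ v in Ioo (0 : ℝ) 1,
        f ![v ^ (α₁ / (α₁ + α₂)), s * v ^ (α₂ / (α₁ + α₂))]‖ₑ := by
  have hA : 0 < α₁ + α₂ := by positivity
  have hmaps : MapsTo (fun z : ℝ × ℝ =>
      (![z.2 ^ (α₁ / (α₁ + α₂)), z.1 * z.2 ^ (α₂ / (α₁ + α₂))] : Fin 2 → ℝ))
      (Ioo c d ×ˢ Ioo (0 : ℝ) 1) (V1 α₁ α₂ c d) := fun z hz => rpow_mem_V1 hA hz.1 hz.2
  have hcont : ContinuousOn (fun z : ℝ × ℝ =>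
      (![z.2 ^ (α₁ / (α₁ + α₂)), z.1 * z.2 ^ (α₂ / (α₁ + α₂))] : Fin 2 → ℝ))
      (Ioo c d ×ˢ Ioo (0 : ℝ) 1) := by
    have hpow : ∀ r : ℝ, 0 < r → Continuous fun z : ℝ × ℝ => z.2 ^ r := fun r hr =>
      continuous_snd.rpow_const fun _ => Or.inr hr.le
    refine (continuous_pi fun i => ?_).continuousOn
    fin_cases i
    · exact hpow _ (by positivity)
    · exact continuous_fst.mul (hpow _ (by positivity))
  have hint : IntegrableOn (fun z : ℝ × ℝ =>
      f ![z.2 ^ (α₁ / (α₁ + α₂)), z.1 * z.2 ^ (α₂ / (α₁ + α₂))])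
      (Ioo c d ×ˢ Ioo (0 : ℝ) 1) (volume.prod volume) := by
    have hmeas : AEStronglyMeasurable _
        (((volume : Measure ℝ).prod volume).restrict (Ioo c d ×ˢ Ioo (0 : ℝ) 1)) :=
      (hf.comp hcont hmaps).aestronglyMeasurable (measurableSet_Ioo.prod measurableSet_Ioo)
    refine Integrable.mono' (g := fun _ => 1) (integrableOn_const ?_) hmeas
      (Filter.Eventually.of_forall fun z => hf1 _)
    rw [Measure.prod_prod]
    exact ENNReal.mul_ne_top (by simp) (by simp)
  rw [setIntegral_V1_eq hα₁ hα₂, enorm_smul, Real.enorm_of_nonneg (by positivity)]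
  gcongr
  rw [Measure.volume_eq_prod, setIntegral_prod _ hint]
  exact enorm_integral_le_lintegral_enorm _

theorem hasDerivAt_iterate_deriv {f : ℝ → Fin 2 → ℝ} {a b : ℝ}
    (hf : ∀ s ∈ Ioo a b, AnalyticAt ℝ f s) (i : ℕ) (j : Fin 2) {s : ℝ} (hs : s ∈ Ioo a b) :
    HasDerivAt (fun s => deriv^[i] (fun u => f u j) s) (deriv^[i + 1] (fun u => f u j) s) s := by
  have hj : AnalyticAt ℝ (fun u => f u j) s :=
    (ContinuousLinearMap.proj (R := ℝ) (φ := fun _ : Fin 2 => ℝ) j).analyticAt _ |>.comp (hf s hs)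
  rw [Function.iterate_succ_apply']
  exact (hj.iterated_deriv i).differentiableAt.hasDerivAt

theorem map_rpow_of_homogeneous {α₁ α₂ m a b s v : ℝ} {φ : (Fin 2 → ℝ) → Fin 2 → ℝ}
    (hα : 0 < α₁ + α₂)
    (hφ : ∀ x ∈ Vab α₁ α₂ a b, ∀ t : ℝ, 0 < t → φ (dil α₁ α₂ t x) = t ^ m • φ x)
    (hs : s ∈ Ioo a b) (hv : 0 < v) :
    φ ![v ^ (α₁ / (α₁ + α₂)), s * v ^ (α₂ / (α₁ + α₂))] = v ^ (m / (α₁ + α₂)) • φ ![1, s] := by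
  have h := hφ ![1, s] ⟨s, 1, hs.1, hs.2, one_pos, (dil_one _ _ _).symm⟩ (v ^ (α₁ + α₂)⁻¹)
    (Real.rpow_pos_of_pos hv _)
  rwa [dil_eq_rpow hα.ne' (Real.rpow_nonneg hv.le _), Real.rpow_inv_rpow hv.le hα.ne',
    ← Real.rpow_mul hv.le, inv_mul_eq_div] at h

theorem onS1_inv_smul {ξ : Fin 2 → ℝ} (hξ : ξ ≠ 0) :
    0 < √(ξ 0 ^ 2 + ξ 1 ^ 2) ∧ onS1 ((√(ξ 0 ^ 2 + ξ 1 ^ 2))⁻¹ • ξ) := by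
  have hpos : 0 < ξ 0 ^ 2 + ξ 1 ^ 2 := by
    by_contra! h
    refine hξ (funext fun i => ?_)
    have h0 : ξ 0 = 0 := by nlinarith [sq_nonneg (ξ 0), sq_nonneg (ξ 1)]
    have h1 : ξ 1 = 0 := by nlinarith [sq_nonneg (ξ 0), sq_nonneg (ξ 1)]
    fin_cases i
    exacts [h0, h1]
  refine ⟨Real.sqrt_pos.2 hpos, ?_⟩
  simp only [onS1, Pi.smul_apply, smul_eq_mul, mul_pow, inv_pow, Real.sq_sqrt hpos.le]
  field_simp

theorem exists_enorm_integral_dilation_curve_le {α₁ α₂ m a b : ℝ} {φ : (Fin 2 → ℝ) → Fin 2 → ℝ}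
    (hα₁ : 0 < α₁) (hα₂ : 0 < α₂) (hm : 3 * (α₁ + α₂) ≤ m)
    (hφ : ∀ x ∈ Vab α₁ α₂ a b, ∀ t : ℝ, 0 < t → φ (dil α₁ α₂ t x) = t ^ m • φ x) :
    ∃ K : ℝ, 0 < K ∧ ∀ s ∈ Ioo a b, ∀ ξ' ξ'' : Fin 2 → ℝ,
      ‖∫ v in Ioo (0 : ℝ) 1, Complex.exp (-Complex.I *
        ((dot2 ![v ^ (α₁ / (α₁ + α₂)), s * v ^ (α₂ / (α₁ + α₂))] ξ' +
          dot2 (φ ![v ^ (α₁ / (α₁ + α₂)), s * v ^ (α₂ / (α₁ + α₂))]) ξ'' : ℝ) : ℂ))‖ₑ ≤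
      ENNReal.ofReal K * ENNReal.ofReal |dot2 (φ ![1, s]) ξ''| ^ (-((α₁ + α₂) / m)) := by
  have hA : 0 < α₁ + α₂ := by positivity
  have hm0 : 0 < m := by linarith
  obtain ⟨K, hK, h⟩ := exists_norm_integral_exp_le_rpow (p := α₁ / (α₁ + α₂))
    (q := α₂ / (α₁ + α₂)) (M := m / (α₁ + α₂)) (by positivity) (by positivity)
    (by field_simp) ((le_div_iff₀ hA).2 hm)
  refine ⟨K, hK, fun s hs ξ' ξ'' => ?_⟩
  rcases eq_or_ne (dot2 (φ ![1, s]) ξ'') 0 with h0 | h0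
  · rw [h0, abs_zero, ENNReal.ofReal_zero, ENNReal.zero_rpow_of_neg (by simp; positivity),
      ENNReal.mul_top (by simpa using hK)]
    exact le_top
  · have key := h (-ξ' 0) (-(s * ξ' 1)) (-dot2 (φ ![1, s]) ξ'') (neg_ne_zero.2 h0)
    rw [intervalIntegral.integral_of_le zero_le_one, integral_Ioc_eq_integral_Ioo, abs_neg,
      one_div_div] at key
    rw [ENNReal.ofReal_rpow_of_pos (abs_pos.2 h0), ← ENNReal.ofReal_mul hK.le,
      ← ofReal_norm]
    refine ENNReal.ofReal_le_ofReal ((le_of_eq ?_).trans key)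
    congr 1
    refine setIntegral_congr_fun measurableSet_Ioo fun v hv => ?_
    simp only [map_rpow_of_homogeneous hA hφ hs hv.1]
    congr 1
    simp [dot2]
    ring

/-- Decay estimate for the Fourier transform of the measure `μ`:
`|μ̂(ξ′,ξ″)| ≤ C |ξ″|^{−(α₁+α₂)/m}`. -/
theorem stmt_12 (α₁ α₂ m a b : ℝ) (φ : (Fin 2 → ℝ) → Fin 2 → ℝ)
    (hα₁ : 0 < α₁) (hα₂ : 0 < α₂) (hαne : α₁ ≠ α₂) (hab : a < b)
    (hm : 3 * (α₁ + α₂) ≤ m)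
    (H1 : AnalyticOnNhd ℝ φ (Vab α₁ α₂ a b))
    (H2 : ∀ x ∈ Vab α₁ α₂ a b, ∀ t : ℝ, 0 < t → φ (dil α₁ α₂ t x) = t ^ m • φ x)
    (c d σ : ℝ) (hac : a < c) (hcd : c < d) (hdb : d < b) (hσ : σ ∈ Set.Icc c d)
    (H3 : {x | x ∈ closure (Vab α₁ α₂ c d) ∧ x ≠ 0 ∧ ¬ Elliptic φ x}
        = {x | ∃ t : ℝ, 0 < t ∧ x = dil α₁ α₂ t ![1, σ]})
    (n₁ n₂ : ℕ) (hn₁ : 0 < n₁) (hn₂ : 0 < n₂)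
    (hn : ((max n₁ n₂ : ℕ) : ℝ) < 2 * m / (α₁ + α₂) - 3)
    (D δ : ℝ) (hD : 0 < D) (hδ : 0 < δ)
    (H4a : σ ∈ Set.Ioc c d → ∀ s ∈ Set.Ioo (σ - δ) σ, ∀ t : ℝ, 0 < t →
      ∀ ζ : Fin 2 → ℝ, onS1 ζ →
        D * t ^ (2 * (m - α₁ - α₂)) * |s - σ| ^ n₁ ≤ |Qform φ (dil α₁ α₂ t ![1, s]) ζ|)
    (H4b : σ ∈ Set.Ico c d → ∀ s ∈ Set.Ioo σ (σ + δ), ∀ t : ℝ, 0 < t →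
      ∀ ζ : Fin 2 → ℝ, onS1 ζ →
        D * t ^ (2 * (m - α₁ - α₂)) * |s - σ| ^ n₂ ≤ |Qform φ (dil α₁ α₂ t ![1, s]) ζ|) :
    ∃ C : ℝ, 0 < C ∧ ∀ ξ' ξ'' : Fin 2 → ℝ, ξ'' ≠ 0 →
      ‖∫ x in V1 α₁ α₂ c d,
          Complex.exp (-Complex.I * ((dot2 x ξ' + dot2 (φ x) ξ'' : ℝ) : ℂ))‖ ≤
        C * Real.sqrt (ξ'' 0 ^ 2 + ξ'' 1 ^ 2) ^ (-((α₁ + α₂) / m)) := by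
  have hA : 0 < α₁ + α₂ := by positivity
  have hm0 : 0 < m := by linarith
  have hsub : Icc c d ⊆ Ioo a b := Icc_subset_Ioo hac hdb
  have hV1 : V1 α₁ α₂ c d ⊆ Vab α₁ α₂ a b := by
    rintro x ⟨s, t, hc, hd, h0, -, rfl⟩
    exact ⟨s, t, hac.trans hc, hd.trans hdb, h0, rfl⟩
  have han : ∀ s ∈ Ioo a b, AnalyticAt ℝ (fun s => φ ![1, s]) s := fun s hs =>
    (H1 ![1, s] ⟨s, 1, hs.1, hs.2, one_pos, (dil_one _ _ _).symm⟩).comp_of_eq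
      (analyticAt_pi_iff.2 fun i => by fin_cases i <;> simp <;> fun_prop) rfl
  let g : ℕ → ℝ → Fin 2 → ℝ := fun i s j => deriv^[i] (fun u => φ ![1, u] j) s
  have hg0 : ∀ s, g 0 s = φ ![1, s] := fun s => rfl
  have hg : ∀ i j, ∀ s ∈ Ioo a b, HasDerivAt (fun s => g i s j) (g (i + 1) s j) s :=
    fun i j s hs => hasDerivAt_iterate_deriv han i j hs
  have hn' : ∀ n ≤ max n₁ n₂, (n : ℝ) < 2 * m / (α₁ + α₂) - 3 := fun n hle =>
    lt_of_le_of_lt (by exact_mod_cast hle) hn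
  have hord : ∀ ζ, onS1 ζ → ∀ s ∈ Icc c d,
      ∃ k : ℕ, k * ((α₁ + α₂) / m) < 1 ∧ dot2 (g k s) ζ ≠ 0 := by
    intro ζ hζ s hs
    refine exists_dot2_ne_zero hα₁ hα₂ hm H2 hg0 hg (hsub hs) ?_ hζ
    rcases eq_or_ne s σ with rfl | hne
    · rcases hs.2.eq_or_lt with rfl | hlt
      · refine Or.inr ⟨n₁, hn' _ (le_max_left _ _), D, δ, hD, hδ, Or.inl fun u hu ζ hζ => ?_⟩
        simpa [dil_one] using H4a ⟨hcd, le_rfl⟩ u hu 1 one_pos ζ hζ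
      · refine Or.inr ⟨n₂, hn' _ (le_max_right _ _), D, δ, hD, hδ, Or.inr fun u hu ζ hζ => ?_⟩
        simpa [dil_one] using H4b ⟨hs.1, hlt⟩ u hu 1 one_pos ζ hζ
    · exact Or.inl (elliptic_of_ne hα₁ hcd H3 hs hne)
  obtain ⟨B, hB, hBle⟩ := exists_setLIntegral_dot2_rpow_neg_le hac hdb
    (r := (α₁ + α₂) / m) (by positivity) hg hord
  obtain ⟨K, hK, hKle⟩ := exists_enorm_integral_dilation_curve_le hα₁ hα₂ hm H2
  set r := (α₁ + α₂) / m with hr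
  refine ⟨α₁ / (α₁ + α₂) * (K * B.toReal) + 1, by positivity, fun ξ' ξ'' hξ => ?_⟩
  obtain ⟨hpos, hS⟩ := onS1_inv_smul hξ
  set L := √(ξ'' 0 ^ 2 + ξ'' 1 ^ 2) with hL
  have hdot : ∀ u, |dot2 u ξ''| = L * |dot2 u (L⁻¹ • ξ'')| := fun u => by
    rw [← abs_of_pos hpos, ← abs_mul, abs_of_pos hpos]
    congr 1
    simp only [dot2, Pi.smul_apply, smul_eq_mul]
    field_simp
  have hcont : ContinuousOn (fun x => Complex.exp (-Complex.I *
      ((dot2 x ξ' + dot2 (φ x) ξ'' : ℝ) : ℂ))) (V1 α₁ α₂ c d) := by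
    have hφc : ∀ j, ContinuousOn (fun x => φ x j) (V1 α₁ α₂ c d) :=
      continuousOn_pi.1 (H1.continuousOn.mono hV1)
    have h0 := hφc 0
    have h1 := hφc 1
    unfold dot2
    fun_prop
  have hE := enorm_setIntegral_V1_le hα₁ hα₂ hcont fun x => by
    rw [neg_mul, ← mul_neg, ← Complex.ofReal_neg, mul_comm, Complex.norm_exp_ofReal_mul_I]
  have hI : ∫⁻ s in Ioo c d, ‖∫ v in Ioo (0 : ℝ) 1, Complex.exp (-Complex.I *
        ((dot2 ![v ^ (α₁ / (α₁ + α₂)), s * v ^ (α₂ / (α₁ + α₂))] ξ' +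
          dot2 (φ ![v ^ (α₁ / (α₁ + α₂)), s * v ^ (α₂ / (α₁ + α₂))]) ξ'' : ℝ) : ℂ))‖ₑ ≤
      ENNReal.ofReal (K * L ^ (-r)) * B := by
    calc _ ≤ ∫⁻ s in Ioo c d, ENNReal.ofReal (K * L ^ (-r)) *
          ENNReal.ofReal |dot2 (g 0 s) (L⁻¹ • ξ'')| ^ (-r) := by
          refine setLIntegral_mono_ae' measurableSet_Ioo (Filter.Eventually.of_forall
            fun s hs => (hKle s (hsub (Ioo_subset_Icc_self hs)) ξ' ξ'').trans (le_of_eq ?_))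
          rw [hdot, ENNReal.ofReal_mul hpos.le, ENNReal.mul_rpow_of_ne_top
            ENNReal.ofReal_ne_top ENNReal.ofReal_ne_top,
            ENNReal.ofReal_rpow_of_pos hpos, ← mul_assoc, ← ENNReal.ofReal_mul hK.le, hg0]
      _ = ENNReal.ofReal (K * L ^ (-r)) * ∫⁻ s in Ioo c d,
          ENNReal.ofReal |dot2 (g 0 s) (L⁻¹ • ξ'')| ^ (-r) :=
          lintegral_const_mul' _ _ ENNReal.ofReal_ne_top
      _ ≤ _ := by
          gcongr
          exact (lintegral_mono_set Ioo_subset_Icc_self).trans (hBle _ hS)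
  have hfin := hE.trans (mul_le_mul_right hI _)
  rw [← ENNReal.ofReal_toReal hB, ← ENNReal.ofReal_mul (by positivity),
    ← ENNReal.ofReal_mul (by positivity), ← ofReal_norm,
    ENNReal.ofReal_le_ofReal_iff (by positivity)] at hfin
  refine hfin.trans ?_
  have := Real.rpow_pos_of_pos hpos (-r)
  nlinarith

end
end

section
/- Suppose that for some p, q ∈ [1,∞] there exists a positive constant C such that ‖f̂|_Σ‖_{L^q(Σ, dμ)} ≤ C ‖f‖_{L^p(ℝ⁴)} for all Schwartz functions f on ℝ⁴, where ‖f̂|_Σ‖_{L^q(Σ,dμ)} = (∫_{V₁^{c,d}} |f̂(x, φ(x))|^q dx)^{1/q}. Then 1/q ≥ ((α₁ + α₂ + 2m)/(α₁ + α₂)) · (1/p'), where 1/p + 1/p' = 1. -/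
open MeasureTheory Real Set
open scoped ENNReal

noncomputable section

/-- A smooth bump adapted to the box with sides `ρ / l i`. -/
theorem exists_schwartz_box_bump {ι : Type*} [Fintype ι] (l : ι → ℝ) (hl : ∀ i, 0 < l i)
    (ρ : ℝ) (hρ : 0 < ρ) :
    ∃ (g : (ι → ℝ) → ℝ) (f : SchwartzMap (ι → ℝ) ℂ), (∀ x, f x = (g x : ℂ)) ∧
      (∀ x, 0 ≤ g x) ∧ (∀ x, g x ≤ 1) ∧
      (∀ x ∈ Icc (fun i => -(ρ / 2 / l i)) (fun i => ρ / 2 / l i), g x = 1) ∧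
      (∀ x, x ∉ Icc (fun i => -(ρ / l i)) (fun i => ρ / l i) → g x = 0) := by
  let B : ContDiffBump (0 : ι → ℝ) := ⟨ρ / 2, ρ, by positivity, by linarith⟩
  let g : (ι → ℝ) → ℝ := fun x => B (fun i => l i * x i)
  have hg0 : ∀ x, x ∉ Icc (fun i => -(ρ / l i)) (fun i => ρ / l i) → g x = 0 := by
    intro x hx
    apply B.zero_of_le_dist
    by_contra! h
    apply hx
    rw [dist_zero_right, pi_norm_lt_iff (by exact hρ)] at h
    have h' : ∀ i, |x i| ≤ ρ / l i := by
      intro i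
      have := h i
      rw [Real.norm_eq_abs, abs_mul, abs_of_pos (hl i)] at this
      rw [le_div_iff₀ (hl i)]
      change _ < ρ at this
      linarith
    exact ⟨fun i => (abs_le.1 (h' i)).1, fun i => (abs_le.1 (h' i)).2⟩
  have hsm : ContDiff ℝ (⊤ : ℕ∞) fun x => (g x : ℂ) :=
    Complex.ofRealCLM.contDiff.comp (B.contDiff.comp (by fun_prop))
  have hcs : HasCompactSupport fun x => (g x : ℂ) := by
    apply HasCompactSupport.intro
      (isCompact_Icc (a := fun i => -(ρ / l i)) (b := fun i => ρ / l i))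
    intro x hx
    simp [hg0 x hx]
  refine ⟨g, hcs.toSchwartzMap hsm, fun x => rfl, fun x => B.nonneg, fun x => B.le_one, ?_, hg0⟩
  intro x hx
  apply B.one_of_mem_closedBall
  rw [mem_closedBall_zero_iff, pi_norm_le_iff_of_nonneg (by positivity)]
  intro i
  rw [Real.norm_eq_abs, abs_mul, abs_of_pos (hl i)]
  have : |x i| ≤ ρ / 2 / l i := abs_le.2 ⟨hx.1 i, hx.2 i⟩
  rw [le_div_iff₀ (hl i)] at this
  change _ ≤ ρ / 2
  linarith

theorem volume_symmetric_box {ι : Type*} [Fintype ι] (r : ι → ℝ) (hr : ∀ i, 0 ≤ r i) :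
    volume (Icc (fun i => -r i) r) = ENNReal.ofReal (∏ i, 2 * r i) := by
  rw [Real.volume_Icc_pi, ENNReal.ofReal_prod_of_nonneg]
  · exact Finset.prod_congr rfl fun i _ => by congr 1; ring
  · exact fun i _ => mul_nonneg zero_le_two (hr i)

theorem eLpNorm_le_of_box {ι : Type*} [Fintype ι] (f : (ι → ℝ) → ℂ) (r : ι → ℝ)
    (hr : ∀ i, 0 ≤ r i) (h1 : ∀ x, ‖f x‖ ≤ 1) (h0 : ∀ x, x ∉ Icc (fun i => -r i) r → f x = 0)
    (p : ℝ≥0∞) :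
    eLpNorm f p volume ≤ ENNReal.ofReal ((∏ i, 2 * r i) ^ (1 / p.toReal)) := by
  have hle : eLpNorm f p volume ≤
      eLpNorm ((Icc (fun i => -r i) r).indicator fun _ => (1 : ℝ)) p volume := by
    apply eLpNorm_mono
    intro x
    by_cases hx : x ∈ Icc (fun i => -r i) r
    · simpa [indicator_of_mem hx] using h1 x
    · simp [h0 x hx]
  refine hle.trans ((eLpNorm_indicator_const_le _ _).trans ?_)
  rw [volume_symmetric_box r hr, enorm_one, one_mul,
    ENNReal.ofReal_rpow_of_nonneg (Finset.prod_nonneg fun i _ => mul_nonneg zero_le_two (hr i))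
      (by positivity)]

theorem le_norm_ftrans (f : SchwartzMap (Fin 4 → ℝ) ℂ) (g : (Fin 4 → ℝ) → ℝ)
    (hfg : ∀ x, f x = (g x : ℂ)) (hg : ∀ x, 0 ≤ g x) (r : Fin 4 → ℝ) (hr : ∀ i, 0 ≤ r i)
    (hg1 : ∀ x ∈ Icc (fun i => -r i) r, g x = 1) (ξ : Fin 4 → ℝ)
    (hξ : ∀ x, g x ≠ 0 → |dot4 x ξ| ≤ 1) :
    (∏ i, 2 * r i) / 2 ≤ ‖ftrans f ξ‖ := by
  have hfi : Integrable (fun x => (f x)) volume := f.integrable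
  have hgi : Integrable g volume := by
    have := hfi.re
    simpa [hfg] using this
  have hdc : Continuous fun x : Fin 4 → ℝ => dot4 x ξ := by unfold dot4; fun_prop
  have hFi : Integrable (fun x => Complex.exp (-Complex.I * (dot4 x ξ : ℂ)) * f x) volume := by
    refine hfi.bdd_mul (c := 1) (Continuous.aestronglyMeasurable (by fun_prop)) ?_
    filter_upwards with x
    rw [Complex.norm_exp]
    simp
  have hre : (ftrans f ξ).re = ∫ x, Real.cos (dot4 x ξ) * g x := by
    unfold ftrans
    have := (integral_re (𝕜 := ℂ) hFi).symm
    simp only [RCLike.re_to_complex] at this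
    rw [this]
    congr 1
    ext x
    rw [hfg, Complex.re_mul_ofReal, Complex.exp_re]
    simp
  have hcos : ∀ x, g x / 2 ≤ Real.cos (dot4 x ξ) * g x := by
    intro x
    by_cases hx : g x = 0
    · simp [hx]
    · have h1 := hξ x hx
      have h2 := Real.one_sub_sq_div_two_le_cos (x := dot4 x ξ)
      have h3 : (dot4 x ξ) ^ 2 ≤ 1 := (sq_le_one_iff_abs_le_one _).2 h1
      nlinarith [hg x]
  have hcosi : Integrable (fun x => Real.cos (dot4 x ξ) * g x) volume := by
    refine hgi.bdd_mul (c := 1) (Continuous.aestronglyMeasurable (by fun_prop)) ?_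
    filter_upwards with x
    exact Real.abs_cos_le_one _
  have hvol : (∏ i, 2 * r i) ≤ ∫ x, g x := by
    have h1 : ∫ x, (Icc (fun i => -r i) r).indicator (fun _ => (1 : ℝ)) x = ∏ i, 2 * r i := by
      rw [integral_indicator_const _ measurableSet_Icc, measureReal_def,
        volume_symmetric_box r hr, ENNReal.toReal_ofReal
          (Finset.prod_nonneg fun i _ => mul_nonneg zero_le_two (hr i)), smul_eq_mul, mul_one]
    rw [← h1]
    apply integral_mono_of_nonneg _ hgi
    · filter_upwards with x
      by_cases hx : x ∈ Icc (fun i => -r i) r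
      · simp [indicator_of_mem hx, hg1 x hx]
      · simpa [indicator_of_notMem hx] using hg x
    · filter_upwards with x
      exact indicator_nonneg (fun _ _ => zero_le_one) x
  calc (∏ i, 2 * r i) / 2 ≤ (∫ x, g x) / 2 := by linarith
    _ = ∫ x, g x / 2 := (integral_div _ _).symm
    _ ≤ ∫ x, Real.cos (dot4 x ξ) * g x := integral_mono (hgi.div_const 2) hcosi hcos
    _ = (ftrans f ξ).re := hre.symm
    _ ≤ ‖ftrans f ξ‖ := Complex.re_le_norm _

theorem le_eLpNorm_restrict {ι : Type*} [Fintype ι] (F : (ι → ℝ) → ℂ) (V W : Set (ι → ℝ))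
    (hW : MeasurableSet W) (hWV : W ⊆ V) (κ w : ℝ) (hκ : 0 ≤ κ) (hw : 0 < w)
    (hvol : volume W = ENNReal.ofReal w) (hF : ∀ x ∈ W, κ ≤ ‖F x‖) (q : ℝ≥0∞) (hq : 1 ≤ q) :
    ENNReal.ofReal (κ * w ^ (1 / q.toReal)) ≤ eLpNorm F q (volume.restrict V) := by
  have hle : eLpNorm (W.indicator fun _ => κ) q (volume.restrict V) ≤
      eLpNorm F q (volume.restrict V) := by
    apply eLpNorm_mono
    intro x
    by_cases hx : x ∈ W
    · simpa [indicator_of_mem hx, abs_of_nonneg hκ] using hF x hx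
    · simp [indicator_of_notMem hx]
  refine le_trans (le_of_eq ?_) hle
  have hr : (volume.restrict V) W = ENNReal.ofReal w := by
    rw [Measure.restrict_apply hW, inter_eq_left.2 hWV, hvol]
  rw [eLpNorm_indicator_const' hW (by simp [hr, hw]) (by positivity), hr,
    ENNReal.ofReal_rpow_of_pos hw, ENNReal.ofReal_mul hκ, Real.enorm_of_nonneg hκ]

theorem exponent_nonneg_of_rpow_le (e A : ℝ) (h : ∀ ε : ℝ, 0 < ε → ε < 1 → ε ^ e ≤ A) :
    0 ≤ e := by
  by_contra! he
  have ht := tendsto_rpow_neg_nhdsGT_zero he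
  have h1 := ht.eventually (Filter.eventually_gt_atTop A)
  have h2 : ∀ᶠ ε : ℝ in nhdsWithin 0 (Ioi 0), ε ∈ Ioo (0 : ℝ) 1 := Ioo_mem_nhdsGT one_pos
  obtain ⟨ε, h3, h4⟩ := (h1.and h2).exists
  exact absurd (h ε h4.1 h4.2) (not_le.2 h3)

theorem exists_box_subset_V1 (α₁ α₂ c d : ℝ) (hα₁ : 0 < α₁) (hcd : c < d) :
    ∃ δ u : ℝ, 0 < δ ∧ δ ≤ 1 ∧ ∀ ε : ℝ, 0 < ε → ∀ x : Fin 2 → ℝ,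
      x ∈ pi univ (fun i => Ioo ((![ε ^ α₁ * (1 - δ), ε ^ α₂ * u] : Fin 2 → ℝ) i)
        ((![ε ^ α₁, ε ^ α₂ * (u + δ)] : Fin 2 → ℝ) i)) →
      ∃ s t : ℝ, c < s ∧ s < d ∧ 0 < t ∧ t < ε ∧ x = dil α₁ α₂ t ![1, s] := by
  have hcont : ContinuousAt (fun z : ℝ × ℝ => z.2 * z.1 ^ (-(α₂ / α₁))) (1, (c + d) / 2) := by
    apply ContinuousAt.mul continuousAt_snd
    exact continuousAt_fst.rpow_const (Or.inl one_ne_zero)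
  have hev := hcont.eventually (Ioo_mem_nhds (a := c) (b := d) (by simp; linarith)
    (by simp; linarith))
  obtain ⟨δ, hδ, hball⟩ := Metric.eventually_nhds_iff.1 hev
  refine ⟨min δ 1, (c + d) / 2, by positivity, min_le_right _ _, ?_⟩
  intro ε hε x hx
  have hx0 := hx 0 (mem_univ _)
  have hx1 := hx 1 (mem_univ _)
  simp only [Matrix.cons_val_zero, Matrix.cons_val_one, mem_Ioo] at hx0 hx1
  have he1 : 0 < ε ^ α₁ := by positivity
  have he2 : 0 < ε ^ α₂ := by positivity
  obtain ⟨z, hz⟩ : ∃ z, x 0 = ε ^ α₁ * z := ⟨x 0 / ε ^ α₁, by field_simp⟩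
  obtain ⟨w, hw⟩ : ∃ w, x 1 = ε ^ α₂ * w := ⟨x 1 / ε ^ α₂, by field_simp⟩
  rw [hz] at hx0
  rw [hw] at hx1
  have hz1 : 1 - min δ 1 < z := lt_of_mul_lt_mul_left hx0.1 he1.le
  have hz2 : z < 1 := by
    have : ε ^ α₁ * z < ε ^ α₁ * 1 := by linarith [hx0.2]
    exact lt_of_mul_lt_mul_left this he1.le
  have hw1 := lt_of_mul_lt_mul_left hx1.1 he2.le
  have hw2 := lt_of_mul_lt_mul_left hx1.2 he2.le
  have hz0 : 0 < z := by linarith [min_le_right δ 1]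
  have hmem : w * z ^ (-(α₂ / α₁)) ∈ Ioo c d := by
    apply hball (y := (z, w))
    rw [Prod.dist_eq, max_lt_iff, Real.dist_eq, Real.dist_eq, abs_lt, abs_lt]
    have := min_le_left δ 1
    refine ⟨⟨?_, ?_⟩, ?_, ?_⟩ <;> simp only <;> linarith
  have ht1 : z ^ (1 / α₁) < 1 := Real.rpow_lt_one hz0.le hz2 (by positivity)
  have ht0 : 0 < z ^ (1 / α₁) := by positivity
  refine ⟨w * z ^ (-(α₂ / α₁)), ε * z ^ (1 / α₁), hmem.1, hmem.2, by positivity,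
    by nlinarith, ?_⟩
  have h1 : (ε * z ^ (1 / α₁)) ^ α₁ = ε ^ α₁ * z := by
    rw [Real.mul_rpow hε.le ht0.le, ← Real.rpow_mul hz0.le, one_div_mul_cancel hα₁.ne',
      Real.rpow_one]
  have h2 : (ε * z ^ (1 / α₁)) ^ α₂ * (w * z ^ (-(α₂ / α₁))) = ε ^ α₂ * w := by
    have h3 : (z ^ (1 / α₁)) ^ α₂ * z ^ (-(α₂ / α₁)) = 1 := by
      rw [← Real.rpow_mul hz0.le, ← Real.rpow_add hz0]
      rw [show 1 / α₁ * α₂ + -(α₂ / α₁) = 0 by ring, Real.rpow_zero]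
    rw [Real.mul_rpow hε.le ht0.le]
    linear_combination ε ^ α₂ * w * h3
  funext i
  fin_cases i
  · exact hz.trans (h1.symm.trans (mul_one _).symm)
  · exact hw.trans h2.symm

theorem exists_abs_graphMap_le (α₁ α₂ m a b : ℝ) (φ : (Fin 2 → ℝ) → Fin 2 → ℝ)
    (H1 : AnalyticOnNhd ℝ φ (Vab α₁ α₂ a b))
    (H2 : ∀ x ∈ Vab α₁ α₂ a b, ∀ t : ℝ, 0 < t → φ (dil α₁ α₂ t x) = t ^ m • φ x)
    (c d : ℝ) (hac : a < c) (hdb : d < b) :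
    ∃ R : ℝ, 0 < R ∧ ∀ s t : ℝ, c < s → s < d → 0 < t → ∀ i,
      |graphMap φ (dil α₁ α₂ t ![1, s]) i| ≤ R * (![t ^ α₁, t ^ α₂, t ^ m, t ^ m] : Fin 4 → ℝ) i := by
  have hV : ∀ s ∈ Icc c d, ![1, s] ∈ Vab α₁ α₂ a b := fun s hs =>
    ⟨s, 1, hac.trans_le hs.1, hs.2.trans_lt hdb, one_pos, by simp [dil]⟩
  have hc : ContinuousOn (fun s : ℝ => φ ![1, s]) (Icc c d) := by
    apply H1.continuousOn.comp (f := fun s : ℝ => (![1, s] : Fin 2 → ℝ)) _ hV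
    apply Continuous.continuousOn
    refine continuous_pi fun i => ?_
    fin_cases i
    · exact continuous_const
    · exact continuous_id
  obtain ⟨M, hM⟩ := isCompact_Icc.exists_bound_of_continuousOn hc
  refine ⟨max (max 1 M) (max |c| |d|), by positivity, ?_⟩
  intro s t hs1 hs2 ht i
  have hs : s ∈ Icc c d := ⟨hs1.le, hs2.le⟩
  have hb : ∀ j, |φ ![1, s] j| ≤ M := fun j => (norm_le_pi_norm (φ ![1, s]) j).trans (hM s hs)
  have hsd : |s| ≤ max |c| |d| := abs_le_max_abs_abs hs1.le hs2.le
  have h1 : (1 : ℝ) ≤ max (max 1 M) (max |c| |d|) := (le_max_left _ _).trans (le_max_left _ _)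
  have h2 : M ≤ max (max 1 M) (max |c| |d|) := (le_max_right _ _).trans (le_max_left _ _)
  have h3 : |s| ≤ max (max 1 M) (max |c| |d|) := hsd.trans (le_max_right _ _)
  generalize max (max 1 M) (max |c| |d|) = R at h1 h2 h3 ⊢
  have key : ∀ (e v : ℝ), |v| ≤ R → |t ^ e * v| ≤ R * t ^ e := by
    intro e v hv
    have : 0 < t ^ e := by positivity
    rw [abs_mul, abs_of_pos this, mul_comm]
    exact mul_le_mul_of_nonneg_right hv this.le
  have hφ := H2 _ (hV s hs) t ht
  fin_cases i
  · simpa [graphMap, dil] using key α₁ 1 (by simpa using h1)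
  · simpa [graphMap, dil] using key α₂ s h3
  · simpa [graphMap, hφ] using key m _ ((hb 0).trans h2)
  · simpa [graphMap, hφ] using key m _ ((hb 1).trans h2)

/-- Knapp-type necessary condition: an `L^p(ℝ⁴) → L^q(Σ,dμ)` restriction estimate
forces `1/q ≥ ((α₁+α₂+2m)/(α₁+α₂))·(1/p′)`. -/
theorem stmt_13 (α₁ α₂ m a b : ℝ) (φ : (Fin 2 → ℝ) → Fin 2 → ℝ)
    (hα₁ : 0 < α₁) (hα₂ : 0 < α₂) (hαne : α₁ ≠ α₂) (hab : a < b)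
    (hm : 3 * (α₁ + α₂) ≤ m)
    (H1 : AnalyticOnNhd ℝ φ (Vab α₁ α₂ a b))
    (H2 : ∀ x ∈ Vab α₁ α₂ a b, ∀ t : ℝ, 0 < t → φ (dil α₁ α₂ t x) = t ^ m • φ x)
    (c d : ℝ) (hac : a < c) (hcd : c < d) (hdb : d < b)
    (p q : ℝ≥0∞) (hp : 1 ≤ p) (hq : 1 ≤ q) (C : ℝ) (hC : 0 < C)
    (hbound : ∀ f : SchwartzMap (Fin 4 → ℝ) ℂ,
      eLpNorm (fun x : Fin 2 → ℝ => ftrans (⇑f) (graphMap φ x)) q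
          ((volume : Measure (Fin 2 → ℝ)).restrict (V1 α₁ α₂ c d)) ≤
        ENNReal.ofReal C * eLpNorm (⇑f) p (volume : Measure (Fin 4 → ℝ))) :
    ENNReal.ofReal ((α₁ + α₂ + 2 * m) / (α₁ + α₂)) * (1 - 1 / p) ≤ 1 / q := by

  obtain ⟨δ, u, hδ, hδ1, hbox⟩ := exists_box_subset_V1 α₁ α₂ c d hα₁ hcd
  obtain ⟨R, hR, hgraph⟩ := exists_abs_graphMap_le α₁ α₂ m a b φ H1 H2 c d hac hdb
  have hm0 : 0 < m := by linarith
  obtain ⟨ρ, hρ, hρR⟩ : ∃ ρ : ℝ, 0 < ρ ∧ 4 * R * ρ = 1 :=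
    ⟨1 / (4 * R), by positivity, by field_simp⟩
  set P : ℝ := 1 / p.toReal with hP
  set S : ℝ := 1 / q.toReal with hS
  set Q : ℝ := α₁ + α₂ + 2 * m with hQ
  have hscale : ∀ ε : ℝ, 0 < ε → ε < 1 →
      (ρ ^ 4 * ε ^ (-Q)) / 2 * (δ ^ 2 * ε ^ (α₁ + α₂)) ^ S ≤
        C * ((2 * ρ) ^ 4 * ε ^ (-Q)) ^ P := by
    intro ε hε hε1
    let l : Fin 4 → ℝ := ![ε ^ α₁, ε ^ α₂, ε ^ m, ε ^ m]
    have hl : ∀ i, 0 < l i := by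
      intro i
      fin_cases i <;> simp [l] <;> positivity
    have hprod : ∀ r : ℝ, ∏ i, 2 * (r / l i) = (2 * r) ^ 4 * ε ^ (-Q) := by
      intro r
      have hQe : ε ^ (-Q) = (ε ^ α₁ * ε ^ α₂ * ε ^ m * ε ^ m)⁻¹ := by
        rw [Real.rpow_neg hε.le, ← Real.rpow_add hε, ← Real.rpow_add hε, ← Real.rpow_add hε]
        congr 2
        rw [hQ]
        ring
      rw [hQe, Fin.prod_univ_four]
      simp only [l, Matrix.cons_val]
      field_simp
    obtain ⟨g, f, hfg, hg0, hg1, hgin, hgout⟩ := exists_schwartz_box_bump l hl ρ hρ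
    have hup := eLpNorm_le_of_box f (fun i => ρ / l i) (fun i => (div_pos hρ (hl i)).le)
      (fun x => by rw [hfg, Complex.norm_real, Real.norm_eq_abs, abs_of_nonneg (hg0 x)]; exact hg1 x)
      (fun x hx => by rw [hfg, hgout x hx, Complex.ofReal_zero]) p
    rw [hprod] at hup
    let W : Set (Fin 2 → ℝ) := pi univ fun i =>
      Ioo ((![ε ^ α₁ * (1 - δ), ε ^ α₂ * u] : Fin 2 → ℝ) i)
        ((![ε ^ α₁, ε ^ α₂ * (u + δ)] : Fin 2 → ℝ) i)
    have hWvol : volume W = ENNReal.ofReal (δ ^ 2 * ε ^ (α₁ + α₂)) := by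
      rw [Real.volume_pi_Ioo, Fin.prod_univ_two, ← ENNReal.ofReal_mul]
      · congr 1
        simp only [Matrix.cons_val]
        rw [Real.rpow_add hε]
        ring
      · simp only [Matrix.cons_val]
        have : 0 < ε ^ α₁ := by positivity
        nlinarith
    have hlow := le_eLpNorm_restrict (fun x => ftrans f (graphMap φ x)) (V1 α₁ α₂ c d) W
      (MeasurableSet.univ_pi fun i => measurableSet_Ioo)
      (fun x hx => by
        obtain ⟨s, t, h1, h2, h3, h4, h5⟩ := hbox ε hε x hx
        exact ⟨s, t, h1, h2, h3, h4.trans hε1, h5⟩)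
      ((ρ ^ 4 * ε ^ (-Q)) / 2) (δ ^ 2 * ε ^ (α₁ + α₂)) (by positivity) (by positivity) hWvol
      (fun x hx => by
        obtain ⟨s, t, h1, h2, h3, h4, rfl⟩ := hbox ε hε x hx
        have hξ : ∀ i, |graphMap φ (dil α₁ α₂ t ![1, s]) i| ≤ R * l i := by
          intro i
          refine (hgraph s t h1 h2 h3 i).trans (mul_le_mul_of_nonneg_left ?_ hR.le)
          fin_cases i <;> simp [l] <;> gcongr
        have := le_norm_ftrans f g hfg hg0 (fun i => ρ / 2 / l i)
          (fun i => (div_pos (half_pos hρ) (hl i)).le) hgin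
          (graphMap φ (dil α₁ α₂ t ![1, s])) (fun y hy => by
            have hyb : y ∈ Icc (fun i => -(ρ / l i)) (fun i => ρ / l i) := by
              by_contra h
              exact hy (hgout y h)
            have hi : ∀ i, |y i * graphMap φ (dil α₁ α₂ t ![1, s]) i| ≤ R * ρ := by
              intro i
              have hyi : |y i| ≤ ρ / l i := abs_le.2 ⟨hyb.1 i, hyb.2 i⟩
              rw [abs_mul]
              calc _ ≤ ρ / l i * (R * l i) :=
                    mul_le_mul hyi (hξ i) (abs_nonneg _) (div_pos hρ (hl i)).le
                _ = R * ρ := by have := (hl i).ne'; field_simp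
            have e0 := abs_le.1 (hi 0)
            have e1 := abs_le.1 (hi 1)
            have e2 := abs_le.1 (hi 2)
            have e3 := abs_le.1 (hi 3)
            unfold dot4
            rw [abs_le]
            constructor <;> linarith)
        rwa [hprod, mul_div_cancel₀ ρ two_ne_zero] at this) q hq
    have hfin := hlow.trans ((hbound f).trans (mul_le_mul_right hup _))
    rw [← ENNReal.ofReal_mul hC.le, ENNReal.ofReal_le_ofReal_iff (by positivity)] at hfin
    exact hfin
  have hexp : 0 ≤ (α₁ + α₂) * S - Q + Q * P := by
    apply exponent_nonneg_of_rpow_le _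
      (C * ((2 * ρ) ^ 4) ^ P / (ρ ^ 4 / 2 * (δ ^ 2) ^ S))
    intro ε hε hε1
    rw [le_div_iff₀ (by positivity)]
    have h := hscale ε hε hε1
    rw [Real.mul_rpow (by positivity) (by positivity), Real.mul_rpow (by positivity) (by positivity),
      ← Real.rpow_mul hε.le, ← Real.rpow_mul hε.le] at h
    have h' := mul_le_mul_of_nonneg_right h (Real.rpow_nonneg hε.le (Q * P))
    have e1 : ε ^ ((α₁ + α₂) * S - Q + Q * P) =
        ε ^ (-Q) * ε ^ ((α₁ + α₂) * S) * ε ^ (Q * P) := by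
      rw [← Real.rpow_add hε, ← Real.rpow_add hε]
      congr 1
      ring
    have e2 : ε ^ (-Q * P) * ε ^ (Q * P) = 1 := by
      rw [← Real.rpow_add hε, show -Q * P + Q * P = 0 by ring, Real.rpow_zero]
    rw [e1]
    linear_combination h' + C * ((2 * ρ) ^ 4) ^ P * e2
  have hp0 : p ≠ 0 := by positivity
  have hq0 : q ≠ 0 := by positivity
  have hpP : 1 / p = ENNReal.ofReal P := by
    rw [hP, one_div, one_div, ← ENNReal.toReal_inv, ENNReal.ofReal_toReal (by simpa using hp0)]
  have hqS : 1 / q = ENNReal.ofReal S := by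
    rw [hS, one_div, one_div, ← ENNReal.toReal_inv, ENNReal.ofReal_toReal (by simpa using hq0)]
  have hPnn : 0 ≤ P := by positivity
  have hα : 0 < α₁ + α₂ := by linarith
  rw [hpP, hqS, ← ENNReal.ofReal_one, ← ENNReal.ofReal_sub _ hPnn,
    ← ENNReal.ofReal_mul (by positivity)]
  apply ENNReal.ofReal_le_ofReal
  rw [div_mul_eq_mul_div, div_le_iff₀ hα]
  linarith

end
end

section
/- Let μ be the Borel measure on ℝ⁴ given by μ(E) = ∫_{V₁^{c,d}} χ_E(x, φ(x)) dx. Suppose that for some p, q ∈ [1,∞] there exists a positive constant C such that ‖μ ∗ f‖_{L^q(ℝ⁴)} ≤ C ‖f‖_{L^p(ℝ⁴)} for all Schwartz functions f on ℝ⁴. Then 1/q ≥ 1/p − (α₁+α₂)/(α₁+α₂+2m). -/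
open MeasureTheory Real Set
open scoped ENNReal

noncomputable section

lemma mem_V1_iff {α₁ α₂ c d : ℝ} (hα₁ : 0 < α₁) (x : Fin 2 → ℝ) :
    x ∈ V1 α₁ α₂ c d ↔ 0 < x 0 ∧ x 0 < 1 ∧ c * x 0 ^ (α₂ / α₁) < x 1 ∧
      x 1 < d * x 0 ^ (α₂ / α₁) := by
  constructor
  · rintro ⟨s, t, hcs, hsd, ht, ht1, rfl⟩
    have hpow : (t ^ α₁) ^ (α₂ / α₁) = t ^ α₂ := by
      rw [← Real.rpow_mul ht.le, mul_div_cancel₀ _ hα₁.ne']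
    have hpos : 0 < t ^ α₂ := Real.rpow_pos_of_pos ht _
    simp only [dil, Matrix.cons_val_zero, Matrix.cons_val_one, mul_one, hpow]
    refine ⟨Real.rpow_pos_of_pos ht _, Real.rpow_lt_one ht.le ht1 hα₁, ?_, ?_⟩ <;>
      nlinarith
  · rintro ⟨h0, h1, hc, hd⟩
    have hpos : 0 < x 0 ^ (α₂ / α₁) := Real.rpow_pos_of_pos h0 _
    refine ⟨x 1 / x 0 ^ (α₂ / α₁), x 0 ^ (1 / α₁), (lt_div_iff₀ hpos).2 hc,
      (div_lt_iff₀ hpos).2 hd, Real.rpow_pos_of_pos h0 _,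
      Real.rpow_lt_one h0.le h1 (by positivity), ?_⟩
    have e1 : (x 0 ^ (1 / α₁)) ^ α₁ = x 0 := by
      rw [← Real.rpow_mul h0.le, one_div_mul_cancel hα₁.ne', Real.rpow_one]
    have e2 : (x 0 ^ (1 / α₁)) ^ α₂ = x 0 ^ (α₂ / α₁) := by
      rw [← Real.rpow_mul h0.le]; congr 1; ring
    funext i
    fin_cases i
    · simp only [dil, e1]; simp
    · simp only [dil, e2]; simp [mul_div_cancel₀ _ hpos.ne']

lemma isOpen_V1 {α₁ α₂ c d : ℝ} (hα₁ : 0 < α₁) (hα₂ : 0 < α₂) : IsOpen (V1 α₁ α₂ c d) := by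
  have hset : V1 α₁ α₂ c d = {x | 0 < x 0 ∧ x 0 < 1 ∧ c * x 0 ^ (α₂ / α₁) < x 1 ∧
      x 1 < d * x 0 ^ (α₂ / α₁)} := Set.ext (mem_V1_iff hα₁)
  have h0 : Continuous fun x : Fin 2 → ℝ => x 0 := continuous_apply 0
  have h1 : Continuous fun x : Fin 2 → ℝ => x 1 := continuous_apply 1
  have hr : Continuous fun x : Fin 2 → ℝ => x 0 ^ (α₂ / α₁) :=
    h0.rpow_const fun _ => Or.inr (by positivity)
  rw [hset]
  exact (isOpen_lt continuous_const h0).inter <| (isOpen_lt h0 continuous_const).inter <|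
    (isOpen_lt (continuous_const.mul hr) h1).inter (isOpen_lt h1 (continuous_const.mul hr))

lemma volume_V1_lt_top {α₁ α₂ c d : ℝ} (hα₁ : 0 < α₁) (hα₂ : 0 < α₂) :
    volume (V1 α₁ α₂ c d) < ⊤ := by
  refine (measure_mono (t := Metric.closedBall 0 (1 + |c| + |d|)) fun x hx => ?_).trans_lt
    measure_closedBall_lt_top
  obtain ⟨h0, h1, hc, hd⟩ := (mem_V1_iff hα₁ x).1 hx
  have hr0 : 0 < x 0 ^ (α₂ / α₁) := Real.rpow_pos_of_pos h0 _
  have hr1 : x 0 ^ (α₂ / α₁) < 1 := Real.rpow_lt_one h0.le h1 (by positivity)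
  rw [mem_closedBall_zero_iff, pi_norm_le_iff_of_nonneg (by positivity)]
  have := abs_nonneg c
  have := abs_nonneg d
  have := neg_abs_le c
  have := le_abs_self d
  intro i
  rw [Real.norm_eq_abs, abs_le]
  fin_cases i
  · simp only [Fin.zero_eta]
    constructor <;> linarith
  · simp only [Fin.mk_one]
    constructor <;> nlinarith

lemma V1_subset_Vab {α₁ α₂ a b c d : ℝ} (hac : a < c) (hdb : d < b) :
    V1 α₁ α₂ c d ⊆ Vab α₁ α₂ a b := by
  rintro x ⟨s, t, hc, hd, ht, -, rfl⟩
  exact ⟨s, t, hac.trans hc, hd.trans hdb, ht, rfl⟩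

lemma dil_mem_V1 {α₁ α₂ c d t : ℝ} (ht : 0 < t) (ht1 : t < 1) {x : Fin 2 → ℝ}
    (hx : x ∈ V1 α₁ α₂ c d) : dil α₁ α₂ t x ∈ V1 α₁ α₂ c d := by
  obtain ⟨s, r, hc, hd, hr, hr1, rfl⟩ := hx
  refine ⟨s, t * r, hc, hd, mul_pos ht hr, by nlinarith, ?_⟩
  funext i
  fin_cases i <;> simp [dil, Real.mul_rpow ht.le hr.le, mul_assoc]

lemma V1_nonempty {α₁ α₂ c d : ℝ} (hcd : c < d) : (V1 α₁ α₂ c d).Nonempty :=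
  ⟨_, (c + d) / 2, 1 / 2, by linarith, by linarith, by norm_num, by norm_num, rfl⟩

lemma exists_Icc_subset_V1 {α₁ α₂ c d : ℝ} (hα₁ : 0 < α₁) (hα₂ : 0 < α₂) (hcd : c < d) :
    ∃ l u : Fin 2 → ℝ, (∀ i, l i < u i) ∧ Icc l u ⊆ V1 α₁ α₂ c d := by
  obtain ⟨z, hz⟩ := V1_nonempty (α₁ := α₁) (α₂ := α₂) hcd
  obtain ⟨ε, hε, hball⟩ := Metric.nhds_basis_closedBall.mem_iff.1
    ((isOpen_V1 hα₁ hα₂).mem_nhds hz)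
  refine ⟨fun i => z i - ε, fun i => z i + ε, fun i => by linarith, fun x hx => hball ?_⟩
  rw [Metric.mem_closedBall, dist_pi_le_iff hε.le]
  intro i
  have := hx.1 i
  have := hx.2 i
  rw [Real.dist_eq, abs_le]
  constructor <;> simp only at * <;> linarith

/-- The weights of the dilation of `ℝ⁴` under which the graph of `φ` is invariant. -/
def graphScale (α₁ α₂ m t : ℝ) : Fin 4 → ℝ := ![t ^ α₁, t ^ α₂, t ^ m, t ^ m]

lemma graphScale_pos {α₁ α₂ m t : ℝ} (ht : 0 < t) (i : Fin 4) : 0 < graphScale α₁ α₂ m t i := by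
  fin_cases i <;> simp [graphScale, Real.rpow_pos_of_pos ht]

lemma prod_graphScale {α₁ α₂ m t : ℝ} (ht : 0 < t) :
    ∏ i, graphScale α₁ α₂ m t i = t ^ (α₁ + α₂ + 2 * m) := by
  rw [Fin.prod_univ_four, two_mul, ← add_assoc, Real.rpow_add ht, Real.rpow_add ht,
    Real.rpow_add ht]
  simp [graphScale]

/-- The axis-parallel box with half-widths `r * w i`, as a closed order interval. -/
def scaledBox (w : Fin 4 → ℝ) (r : ℝ) : Set (Fin 4 → ℝ) :=
  Icc (fun i => -(r * w i)) (fun i => r * w i)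

lemma mem_scaledBox_iff {w : Fin 4 → ℝ} (hw : ∀ i, 0 < w i) {r : ℝ} (hr : 0 ≤ r) (y : Fin 4 → ℝ) :
    y ∈ scaledBox w r ↔ ‖fun i => y i / w i‖ ≤ r := by
  simp only [pi_norm_le_iff_of_nonneg hr, scaledBox, mem_Icc, Pi.le_def, ← forall_and,
    Real.norm_eq_abs, abs_div, abs_of_pos (hw _), div_le_iff₀ (hw _), abs_le]

lemma volume_scaledBox {w : Fin 4 → ℝ} (hw : ∀ i, 0 < w i) {r : ℝ} (hr : 0 ≤ r) :
    volume (scaledBox w r) = ENNReal.ofReal ((2 * r) ^ 4 * ∏ i, w i) := by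
  have h : ∀ i, r * w i - -(r * w i) = 2 * r * w i := fun i => by ring
  rw [scaledBox, Real.volume_Icc_pi]
  simp only [h]
  rw [← ENNReal.ofReal_prod_of_nonneg fun i _ => by have := hw i; positivity,
    Finset.prod_mul_distrib]
  simp

lemma exists_schwartz_scaledBox {w : Fin 4 → ℝ} (hw : ∀ i, 0 < w i) {r : ℝ} (hr : 0 < r) :
    ∃ f : SchwartzMap (Fin 4 → ℝ) ℂ, ∃ g : (Fin 4 → ℝ) → ℝ, (∀ y, f y = g y) ∧
      (∀ y, 0 ≤ g y) ∧ (∀ y, g y ≤ 1) ∧ (∀ y ∈ scaledBox w r, g y = 1) ∧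
      ∀ y ∉ scaledBox w (2 * r), g y = 0 := by
  let B : ContDiffBump (0 : Fin 4 → ℝ) := ⟨r, 2 * r, hr, by linarith⟩
  let g : (Fin 4 → ℝ) → ℝ := fun y => B (fun i => y i / w i)
  have hg0 : ∀ y ∉ scaledBox w (2 * r), g y = 0 := fun y hy => by
    rw [mem_scaledBox_iff hw (by positivity), not_le] at hy
    exact B.zero_of_le_dist (by simpa using hy.le)
  have hgs : ContDiff ℝ (⊤ : ℕ∞) g :=
    B.contDiff.comp (contDiff_pi.2 fun i => (contDiff_apply ℝ ℝ i).div_const _)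
  have hs : HasCompactSupport fun y => (g y : ℂ) :=
    HasCompactSupport.intro (K := scaledBox w (2 * r)) isCompact_Icc fun y hy => by
      simp [hg0 y hy]
  refine ⟨hs.toSchwartzMap (Complex.ofRealCLM.contDiff.comp hgs), g, fun y => rfl,
    fun y => B.nonneg, fun y => B.le_one, fun y hy => ?_, hg0⟩
  rw [mem_scaledBox_iff hw hr.le] at hy
  exact B.one_of_mem_closedBall (by simpa using hy)

lemma continuousOn_graphMap {φ : (Fin 2 → ℝ) → Fin 2 → ℝ} {s : Set (Fin 2 → ℝ)}
    (hφ : ContinuousOn φ s) : ContinuousOn (graphMap φ) s := by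
  have h := continuousOn_pi.1 hφ
  refine continuousOn_pi.2 fun i => ?_
  fin_cases i
  · exact (continuous_apply 0).continuousOn
  · exact (continuous_apply 1).continuousOn
  · exact h 0
  · exact h 1

lemma graphMap_dil {α₁ α₂ m t : ℝ} {φ : (Fin 2 → ℝ) → Fin 2 → ℝ} {x : Fin 2 → ℝ}
    (hx : φ (dil α₁ α₂ t x) = t ^ m • φ x) (i : Fin 4) :
    graphMap φ (dil α₁ α₂ t x) i = graphScale α₁ α₂ m t i * graphMap φ x i := by
  have h0 := congrFun hx 0
  have h1 := congrFun hx 1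
  simp only [dil, Pi.smul_apply, smul_eq_mul] at h0 h1
  fin_cases i <;> simp [graphMap, graphScale, h0, h1, dil]

/-- If `f` is nonnegative, lower bound for `μ ∗ f` by the volume of a set where `f` is `1`. -/
lemma measureReal_le_norm_muConv {α₁ α₂ c d : ℝ} (hα₁ : 0 < α₁) (hα₂ : 0 < α₂)
    {φ : (Fin 2 → ℝ) → Fin 2 → ℝ} (hφ : ContinuousOn φ (V1 α₁ α₂ c d))
    {f : SchwartzMap (Fin 4 → ℝ) ℂ} {g : (Fin 4 → ℝ) → ℝ} (hfg : ∀ y, f y = g y)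
    (hg0 : ∀ y, 0 ≤ g y) (hg1 : ∀ y, g y ≤ 1) {S : Set (Fin 2 → ℝ)} (hS : MeasurableSet S)
    (hSV : S ⊆ V1 α₁ α₂ c d) {y : Fin 4 → ℝ} (hy : ∀ x ∈ S, g (y - graphMap φ x) = 1) :
    volume.real S ≤ ‖muConv α₁ α₂ c d φ f y‖ := by
  have hV := (isOpen_V1 (c := c) (d := d) hα₁ hα₂).measurableSet
  have hfin : IsFiniteMeasure (volume.restrict (V1 α₁ α₂ c d)) :=
    ⟨by simpa using volume_V1_lt_top hα₁ hα₂⟩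
  have hgc : Continuous g := by
    have : g = fun y => (f y).re := by funext y; simp [hfg]
    rw [this]
    exact Complex.continuous_re.comp f.continuous
  have hint : IntegrableOn (fun x => g (y - graphMap φ x)) (V1 α₁ α₂ c d) := by
    refine Integrable.of_bound (C := 1) ?_ (.of_forall fun x => ?_)
    · exact (hgc.comp_continuousOn
        (continuousOn_const.sub (continuousOn_graphMap hφ))).aestronglyMeasurable hV
    · rw [Real.norm_of_nonneg (hg0 _)]
      exact hg1 _
  have hconv : muConv α₁ α₂ c d φ f y = ((∫ x in V1 α₁ α₂ c d, g (y - graphMap φ x) : ℝ) : ℂ) := by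
    simp only [muConv, hfg]
    exact integral_ofReal
  rw [hconv, Complex.norm_real]
  refine le_trans ?_ (le_abs_self _)
  calc volume.real S = ∫ x in S, g (y - graphMap φ x) := by
        rw [setIntegral_congr_fun hS hy]; simp
    _ ≤ _ := setIntegral_mono_set hint (.of_forall fun x => hg0 _) hSV.eventuallyLE

lemma exists_eq_dil_of_mem_Icc {α₁ α₂ t : ℝ} (ht : 0 < t) {l u x : Fin 2 → ℝ}
    (hx : x ∈ Icc (dil α₁ α₂ t l) (dil α₁ α₂ t u)) : ∃ z ∈ Icc l u, x = dil α₁ α₂ t z := by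
  have h1 : 0 < t ^ α₁ := Real.rpow_pos_of_pos ht _
  have h2 : 0 < t ^ α₂ := Real.rpow_pos_of_pos ht _
  have hl0 := hx.1 0
  have hl1 := hx.1 1
  have hu0 := hx.2 0
  have hu1 := hx.2 1
  simp only [dil, Matrix.cons_val_zero, Matrix.cons_val_one] at hl0 hl1 hu0 hu1
  refine ⟨![x 0 / t ^ α₁, x 1 / t ^ α₂], ⟨fun i => ?_, fun i => ?_⟩, funext fun i => ?_⟩
  · fin_cases i
    · simpa [le_div_iff₀ h1, mul_comm] using hl0
    · simpa [le_div_iff₀ h2, mul_comm] using hl1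
  · fin_cases i
    · simpa [div_le_iff₀ h1, mul_comm] using hu0
    · simpa [div_le_iff₀ h2, mul_comm] using hu1
  · fin_cases i
    · simp [dil, mul_div_cancel₀ _ h1.ne']
    · simp [dil, mul_div_cancel₀ _ h2.ne']

lemma volume_Icc_dil {α₁ α₂ t : ℝ} (ht : 0 < t) {l u : Fin 2 → ℝ} (hlu : ∀ i, l i < u i) :
    volume.real (Icc (dil α₁ α₂ t l) (dil α₁ α₂ t u)) =
      t ^ (α₁ + α₂) * ((u 0 - l 0) * (u 1 - l 1)) := by
  have h1 : 0 < t ^ α₁ := Real.rpow_pos_of_pos ht _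
  have h2 : 0 < t ^ α₂ := Real.rpow_pos_of_pos ht _
  have h0 := sub_pos.2 (hlu 0)
  have h3 := sub_pos.2 (hlu 1)
  rw [measureReal_def, Real.volume_Icc_pi, Fin.prod_univ_two, Real.rpow_add ht]
  simp only [dil, Matrix.cons_val_zero, Matrix.cons_val_one, ← mul_sub, ENNReal.toReal_mul]
  rw [ENNReal.toReal_ofReal (by positivity), ENNReal.toReal_ofReal (by positivity)]
  ring

/-- A power inequality valid for all small `t > 0` forces an inequality between the exponents. -/
lemma exponent_le_of_forall_rpow_le {A B K L : ℝ} (hK : 0 < K)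
    (h : ∀ t : ℝ, 0 < t → t < 1 → K * t ^ A ≤ L * t ^ B) : B ≤ A := by
  by_contra! hlt
  have hlim : Filter.Tendsto (fun t : ℝ => L * t ^ (B - A)) (nhdsWithin 0 (Ioi 0)) (nhds 0) := by
    have h0 : Filter.Tendsto (fun t : ℝ => t ^ (B - A)) (nhds 0) (nhds 0) := by
      simpa [Real.zero_rpow (sub_pos.2 hlt).ne'] using
        (Real.continuousAt_rpow_const 0 (B - A) (Or.inr (sub_pos.2 hlt).le)).tendsto
    simpa using (h0.mono_left nhdsWithin_le_nhds).const_mul L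
  refine absurd (ge_of_tendsto (b := K) hlim ?_) (not_le.2 hK)
  filter_upwards [Ioo_mem_nhdsGT (zero_lt_one' ℝ)] with t ht
  have hpos : 0 < t ^ A := Real.rpow_pos_of_pos ht.1 _
  rw [Real.rpow_sub ht.1, ← mul_div_assoc, le_div_iff₀ hpos]
  exact h t ht.1 ht.2

/-- Necessary condition for `L^p → L^q` boundedness of convolution with `μ`:
`1/q ≥ 1/p − (α₁+α₂)/(α₁+α₂+2m)`. -/
theorem stmt_17 (α₁ α₂ m a b : ℝ) (φ : (Fin 2 → ℝ) → Fin 2 → ℝ)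
    (hα₁ : 0 < α₁) (hα₂ : 0 < α₂) (hαne : α₁ ≠ α₂) (hab : a < b)
    (hm : 3 * (α₁ + α₂) ≤ m)
    (H1 : AnalyticOnNhd ℝ φ (Vab α₁ α₂ a b))
    (H2 : ∀ x ∈ Vab α₁ α₂ a b, ∀ t : ℝ, 0 < t → φ (dil α₁ α₂ t x) = t ^ m • φ x)
    (c d : ℝ) (hac : a < c) (hcd : c < d) (hdb : d < b)
    (p q : ℝ≥0∞) (hp : 1 ≤ p) (hq : 1 ≤ q) (C : ℝ) (hC : 0 < C)
    (hbound : ∀ f : SchwartzMap (Fin 4 → ℝ) ℂ,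
      eLpNorm (muConv α₁ α₂ c d φ (⇑f)) q (volume : Measure (Fin 4 → ℝ)) ≤
        ENNReal.ofReal C * eLpNorm (⇑f) p (volume : Measure (Fin 4 → ℝ))) :
    1 / p - ENNReal.ofReal ((α₁ + α₂) / (α₁ + α₂ + 2 * m)) ≤ 1 / q := by
  obtain ⟨l, u, hlu, hsub⟩ := exists_Icc_subset_V1 (α₁ := α₁) (α₂ := α₂) hα₁ hα₂ hcd
  have hVV : V1 α₁ α₂ c d ⊆ Vab α₁ α₂ a b := V1_subset_Vab hac hdb
  have hφ : ContinuousOn φ (V1 α₁ α₂ c d) := H1.continuousOn.mono hVV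
  obtain ⟨M, hM⟩ := (isCompact_Icc (a := l) (b := u)).exists_bound_of_continuousOn
    (continuousOn_graphMap (hφ.mono hsub))
  have hM0 : 0 ≤ M := (norm_nonneg _).trans (hM l (left_mem_Icc.2 fun i => (hlu i).le))
  set v := (u 0 - l 0) * (u 1 - l 1) with hv
  have hvpos : 0 < v := mul_pos (sub_pos.2 (hlu 0)) (sub_pos.2 (hlu 1))
  set D := α₁ + α₂ + 2 * m with hD
  have hDpos : 0 < D := by simp only [hD]; linarith
  have hp0 : p ≠ 0 := (zero_lt_one.trans_le hp).ne'
  have hq0 : q ≠ 0 := (zero_lt_one.trans_le hq).ne'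
  have key : ∀ t : ℝ, 0 < t → t < 1 →
      (v * (2 ^ 4 : ℝ) ^ (1 / q.toReal)) * t ^ (α₁ + α₂ + D * (1 / q.toReal)) ≤
        (C * ((2 * (2 * (1 + M))) ^ 4 : ℝ) ^ (1 / p.toReal)) * t ^ (D * (1 / p.toReal)) := by
    intro t ht ht1
    set w := graphScale α₁ α₂ m t with hw
    have hwpos : ∀ i, 0 < w i := graphScale_pos ht
    obtain ⟨f, g, hfg, hg0, hg1, hgin, hgout⟩ :=
      exists_schwartz_scaledBox hwpos (r := 1 + M) (by linarith)
    have hlow : ∀ y ∈ scaledBox w 1, t ^ (α₁ + α₂) * v ≤ ‖muConv α₁ α₂ c d φ f y‖ := by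
      intro y hy
      rw [hv, ← volume_Icc_dil ht hlu]
      refine measureReal_le_norm_muConv hα₁ hα₂ hφ hfg hg0 hg1 measurableSet_Icc ?_ ?_
      · intro x hx
        obtain ⟨z, hz, rfl⟩ := exists_eq_dil_of_mem_Icc ht hx
        exact dil_mem_V1 ht ht1 (hsub hz)
      · intro x hx
        obtain ⟨z, hz, rfl⟩ := exists_eq_dil_of_mem_Icc ht hx
        refine hgin _ ((mem_scaledBox_iff hwpos (by linarith) _).2 ?_)
        have heq : (fun i => (y - graphMap φ (dil α₁ α₂ t z)) i / w i) =
            (fun i => y i / w i) - graphMap φ z := by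
          funext i
          simp only [Pi.sub_apply, graphMap_dil (H2 z (hVV (hsub hz)) t ht), ← hw, sub_div,
            mul_div_cancel_left₀ _ (hwpos i).ne']
        rw [heq]
        exact (norm_sub_le _ _).trans
          (add_le_add ((mem_scaledBox_iff hwpos zero_le_one _).1 hy) (hM z hz))
    have hvt : 0 ≤ t ^ (α₁ + α₂) * v := by positivity
    have hprod : ∏ i, w i = t ^ D := prod_graphScale ht
    have hlower : ENNReal.ofReal (t ^ (α₁ + α₂) * v * (2 ^ 4 * t ^ D) ^ (1 / q.toReal)) ≤
        eLpNorm (muConv α₁ α₂ c d φ f) q volume := by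
      calc _ = eLpNorm ((scaledBox w 1).indicator fun _ => t ^ (α₁ + α₂) * v) q volume := by
            rw [eLpNorm_indicator_const' (s := scaledBox w 1) measurableSet_Icc _ hq0,
              volume_scaledBox hwpos zero_le_one, hprod, mul_one, Real.enorm_of_nonneg hvt,
              ENNReal.ofReal_mul hvt, ENNReal.ofReal_rpow_of_pos (by positivity)]
            rw [volume_scaledBox hwpos zero_le_one, hprod, Ne, ENNReal.ofReal_eq_zero, not_le]
            positivity
        _ ≤ _ := by
            refine eLpNorm_mono fun y => ?_
            by_cases hy : y ∈ scaledBox w 1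
            · rw [indicator_of_mem hy, Real.norm_of_nonneg hvt]
              exact hlow y hy
            · simp [indicator_of_notMem hy]
    have hupper : eLpNorm f p volume ≤
        ENNReal.ofReal (((2 * (2 * (1 + M))) ^ 4 * t ^ D) ^ (1 / p.toReal)) := by
      calc _ ≤ eLpNorm ((scaledBox w (2 * (1 + M))).indicator fun _ => (1 : ℝ)) p volume := by
            refine eLpNorm_mono fun y => ?_
            rw [hfg, Complex.norm_real, Real.norm_of_nonneg (hg0 y)]
            by_cases hy : y ∈ scaledBox w (2 * (1 + M))
            · simpa [indicator_of_mem hy] using hg1 y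
            · simp [hgout y hy]
        _ ≤ _ := by
            refine (eLpNorm_indicator_const_le _ _).trans ?_
            rw [volume_scaledBox hwpos (by linarith), hprod,
              ENNReal.ofReal_rpow_of_pos (by positivity)]
            simp
    have hfinal := hlower.trans ((hbound f).trans (mul_le_mul_right hupper _))
    rw [← ENNReal.ofReal_mul hC.le, ENNReal.ofReal_le_ofReal_iff (by positivity),
      Real.mul_rpow (by positivity) (by positivity),
      Real.mul_rpow (by positivity) (by positivity), ← Real.rpow_mul ht.le,
      ← Real.rpow_mul ht.le] at hfinal
    rw [Real.rpow_add ht]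
    linarith
  have hexp := exponent_le_of_forall_rpow_le (by positivity) key
  have hreal : 1 / p.toReal ≤ 1 / q.toReal + (α₁ + α₂) / D := by
    have : D * (1 / p.toReal) ≤ D * (1 / q.toReal + (α₁ + α₂) / D) := by
      rw [mul_add, mul_div_cancel₀ _ hDpos.ne']
      linarith
    exact le_of_mul_le_mul_left this hDpos
  rw [tsub_le_iff_right]
  have hfp : 1 / p ≠ ⊤ := by simpa using hp0
  have hfq : 1 / q ≠ ⊤ := by simpa using hq0
  rw [← ENNReal.ofReal_toReal hfp, ← ENNReal.ofReal_toReal hfq,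
    ← ENNReal.ofReal_add ENNReal.toReal_nonneg (by positivity)]
  exact ENNReal.ofReal_le_ofReal (by simpa [ENNReal.toReal_div] using hreal)

end
end
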